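/- arXiv:1910.13191 — 2 statements merged into one kernel-verified Lean document; each statement's English description precedes it below -/
import Mathlib

section
/- There exist a constant C > 0 and ℓ₀ ∈ (0, 1/2) such that for every ℓ with 0 < ℓ < ℓ₀, the high-pass filtered increment of Riemann's non-differentiable function at frequency cutoff ℓ⁻¹/2 satisfies ‖I_{>ℓ⁻¹/2}(ℓ)‖_{L⁴(𝕋)}⁴ ≤ C · ℓ³ · log(ℓ⁻¹). -/
open Real MeasureTheory

/-- `σ k = 1` if `k` is a perfect square, `0` otherwise. -/
noncomputable def sqIndicator (k : ℕ) : ℝ := if IsSquare k then 1 else 0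

/-- The character `e_k(x) = e^{2πikx}`. -/
noncomputable def eChar (k : ℕ) (x : ℝ) : ℂ :=
  Complex.exp (2 * Real.pi * Complex.I * (k : ℂ) * (x : ℂ))

/-- Riemann's non-differentiable function `R(x) = ∑_{k≥1} (σ_k/k) e^{2πikx}
    = ∑_{n≥1} e^{2πin²x}/n²`. -/
noncomputable def RiemannF (x : ℝ) : ℂ :=
  ∑' k : ℕ, ((sqIndicator k / k : ℝ) : ℂ) * eChar k x

/-- High-pass filter `R_{≥N}(x) = ∑_{k ≥ N} (σ_k/k) e^{2πikx}`. -/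
noncomputable def RiemannHigh (N : ℕ) (x : ℝ) : ℂ :=
  ∑' k : ℕ, if N ≤ k then ((sqIndicator k / k : ℝ) : ℂ) * eChar k x else 0

/-- The increment function `I(ℓ)(x) = 2i ∑_{k≥1} (sin(πkℓ)/k) σ_k e^{2πikx}`. -/
noncomputable def increment (ℓ : ℝ) (x : ℝ) : ℂ :=
  2 * Complex.I *
    ∑' k : ℕ, ((Real.sin (Real.pi * k * ℓ) / k * sqIndicator k : ℝ) : ℂ) * eChar k x

/-- The low-pass filtered increment
`I_{≤M}(ℓ)(x) = 2i ∑_{1 ≤ k ≤ M} (sin(πkℓ)/k) σ_k e^{2πikx}`. -/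
noncomputable def incrementLow (M ℓ : ℝ) (x : ℝ) : ℂ :=
  2 * Complex.I *
    ∑' k : ℕ, if 1 ≤ k ∧ (k : ℝ) ≤ M
      then ((Real.sin (Real.pi * k * ℓ) / k * sqIndicator k : ℝ) : ℂ) * eChar k x else 0

/-- The high-pass filtered increment
`I_{>M}(ℓ)(x) = 2i ∑_{k > M} (sin(πkℓ)/k) σ_k e^{2πikx}`. -/
noncomputable def incrementHigh (M ℓ : ℝ) (x : ℝ) : ℂ :=
  2 * Complex.I *
    ∑' k : ℕ, if M < (k : ℝ)
      then ((Real.sin (Real.pi * k * ℓ) / k * sqIndicator k : ℝ) : ℂ) * eChar k x else 0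


lemma continuous_eChar (k : ℕ) : Continuous (eChar k) := by
  unfold eChar; fun_prop

lemma norm_eChar (k : ℕ) (x : ℝ) : ‖eChar k x‖ = 1 := by
  have : (2 * Real.pi * Complex.I * (k : ℂ) * (x : ℂ)) =
      ((2 * Real.pi * k * x : ℝ) : ℂ) * Complex.I := by push_cast; ring
  rw [eChar, this, Complex.norm_exp_ofReal_mul_I]

lemma eChar_add (m n : ℕ) (x : ℝ) : eChar (m + n) x = eChar m x * eChar n x := by
  simp only [eChar, ← Complex.exp_add]
  congr 1
  push_cast
  ring

lemma integral_eChar_mul_conj_of_ne {m n : ℕ} (h : m ≠ n) :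
    ∫ x in (0 : ℝ)..1, eChar m x * (starRingEnd ℂ) (eChar n x) = 0 := by
  have hc : (2 * Real.pi * Complex.I * ((m : ℂ) - n)) ≠ 0 := by
    refine mul_ne_zero Complex.two_pi_I_ne_zero (sub_ne_zero.2 ?_)
    exact_mod_cast h
  have hx : ∀ x : ℝ, eChar m x * (starRingEnd ℂ) (eChar n x) =
      Complex.exp ((2 * Real.pi * Complex.I * ((m : ℂ) - n)) * x) := by
    intro x
    simp only [eChar, ← Complex.exp_conj, ← Complex.exp_add]
    congr 1
    simp only [map_mul, map_ofNat, Complex.conj_ofReal, Complex.conj_I, map_natCast]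
    ring
  simp only [hx]
  rw [integral_exp_mul_complex hc]
  have : Complex.exp (2 * Real.pi * Complex.I * ((m : ℂ) - n) * (1 : ℝ)) = 1 := by
    rw [Complex.exp_eq_one_iff]
    exact ⟨(m : ℤ) - n, by push_cast; ring⟩
  rw [this]
  simp

lemma enorm_integral_eChar_mul_conj_le (A : ℂ) (m n : ℕ) :
    ‖∫ x in (0 : ℝ)..1, A * (eChar m x * (starRingEnd ℂ) (eChar n x))‖ₑ ≤
      if m = n then ‖A‖ₑ else 0 := by
  rw [intervalIntegral.integral_const_mul, enorm_mul]
  split_ifs with h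
  · have : ‖∫ x in (0 : ℝ)..1, eChar m x * (starRingEnd ℂ) (eChar n x)‖ ≤ 1 * |(1 : ℝ) - 0| :=
      intervalIntegral.norm_integral_le_of_norm_le_const fun x _ => by
        simp [norm_eChar]
    have h1 : ‖∫ x in (0 : ℝ)..1, eChar m x * (starRingEnd ℂ) (eChar n x)‖ₑ ≤ 1 := by
      rw [← ofReal_norm]
      exact ENNReal.ofReal_le_one.2 (by simpa using this)
    exact mul_le_of_le_one_right' h1
  · simp [integral_eChar_mul_conj_of_ne h]

/-- The fourth moment of an absolutely convergent trigonometric series is at most its weighted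
additive energy. -/
lemma ofReal_integral_norm_tsum_pow_four_le (a : ℕ → ℂ) (ν : ℕ → ℕ)
    (ha : Summable fun n => ‖a n‖) :
    ENNReal.ofReal (∫ x in (0 : ℝ)..1, ‖∑' n, a n * eChar (ν n) x‖ ^ 4) ≤
      ∑' z : (ℕ × ℕ) × (ℕ × ℕ), if ν z.1.1 + ν z.1.2 = ν z.2.1 + ν z.2.2 then
        ‖a z.1.1‖ₑ * ‖a z.1.2‖ₑ * (‖a z.2.1‖ₑ * ‖a z.2.2‖ₑ) else 0 := by
  set F : ℝ → ℂ := fun x => ∑' n, a n * eChar (ν n) x with hF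
  set A : (ℕ × ℕ) × (ℕ × ℕ) → ℂ := fun z =>
    a z.1.1 * a z.1.2 * (starRingEnd ℂ) (a z.2.1 * a z.2.2) with hA
  set T : (ℕ × ℕ) × (ℕ × ℕ) → ℝ → ℂ := fun z x =>
    A z * (eChar (ν z.1.1 + ν z.1.2) x * (starRingEnd ℂ) (eChar (ν z.2.1 + ν z.2.2) x)) with hT
  have hua : ∀ x, Summable fun n => ‖a n * eChar (ν n) x‖ := by
    intro x
    simpa [norm_eChar] using ha
  have hTsum : ∀ x, HasSum (fun z => T z x) ((‖F x‖ ^ 4 : ℝ) : ℂ) := by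
    intro x
    have h2 := (hua x).mul_norm (hua x)
    have h2c : Summable fun p : ℕ × ℕ => ‖(starRingEnd ℂ)
        (a p.1 * eChar (ν p.1) x * (a p.2 * eChar (ν p.2) x))‖ := by
      simpa only [RCLike.norm_conj] using h2
    have hsq : F x * F x = ∑' p : ℕ × ℕ, a p.1 * eChar (ν p.1) x * (a p.2 * eChar (ν p.2) x) :=
      tsum_mul_tsum_of_summable_norm (hua x) (hua x)
    have hfour : ((‖F x‖ ^ 4 : ℝ) : ℂ) = F x * F x * (starRingEnd ℂ) (F x * F x) := by
      rw [Complex.mul_conj, Complex.normSq_eq_norm_sq, norm_mul]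
      congr 1
      ring
    rw [hfour, hsq, Complex.conj_tsum, tsum_mul_tsum_of_summable_norm h2 h2c]
    have hTz : ∀ z, T z x = a z.1.1 * eChar (ν z.1.1) x * (a z.1.2 * eChar (ν z.1.2) x) *
        (starRingEnd ℂ) (a z.2.1 * eChar (ν z.2.1) x * (a z.2.2 * eChar (ν z.2.2) x)) := by
      intro z
      simp only [hT, hA, eChar_add, map_mul]
      ring
    simp only [hTz]
    exact (h2.mul_norm h2c).of_norm.hasSum
  have hTn : ∀ z x, ‖T z x‖ = ‖A z‖ := by
    intro z x
    simp [hT, norm_eChar]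
  have hAs : Summable fun z => ‖A z‖ := by
    have h2 := ha.mul_norm ha
    have := h2.mul_norm h2
    refine this.congr fun z => ?_
    simp [hA]
  have hHasSum : HasSum (fun z => ∫ x in (0 : ℝ)..1, T z x)
      (∫ x in (0 : ℝ)..1, ((‖F x‖ ^ 4 : ℝ) : ℂ)) := by
    refine intervalIntegral.hasSum_integral_of_dominated_convergence (fun z _ => ‖A z‖)
      (fun z => ?_) (fun z => ?_) ?_ ?_ ?_
    · have := continuous_eChar (ν z.1.1 + ν z.1.2)
      have := continuous_eChar (ν z.2.1 + ν z.2.2)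
      exact Continuous.aestronglyMeasurable (by fun_prop)
    · exact .of_forall fun x _ => (hTn z x).le
    · exact .of_forall fun x _ => hAs
    · exact intervalIntegrable_const
    · exact .of_forall fun x _ => hTsum x
  have hnn : 0 ≤ ∫ x in (0 : ℝ)..1, ‖F x‖ ^ 4 :=
    intervalIntegral.integral_nonneg zero_le_one fun x _ => by positivity
  calc ENNReal.ofReal (∫ x in (0 : ℝ)..1, ‖F x‖ ^ 4)
      = ‖∫ x in (0 : ℝ)..1, ((‖F x‖ ^ 4 : ℝ) : ℂ)‖ₑ := by
        rw [intervalIntegral.integral_ofReal, ← ofReal_norm, Complex.norm_real,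
          Real.norm_of_nonneg hnn]
    _ = ‖∑' z, ∫ x in (0 : ℝ)..1, T z x‖ₑ := by rw [hHasSum.tsum_eq]
    _ ≤ ∑' z, ‖∫ x in (0 : ℝ)..1, T z x‖ₑ := enorm_tsum_le_tsum_enorm
    _ ≤ _ := by
        refine ENNReal.tsum_le_tsum fun z => ?_
        refine (enorm_integral_eChar_mul_conj_le (A z) _ _).trans_eq ?_
        simp only [hA, enorm_mul, map_mul, RCLike.enorm_conj]

/-- If every point satisfies `P` up to an involution preserving `g`, then the sum of `g` is at most
twice its sum over the points satisfying `P`. -/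
lemma tsum_le_two_mul_tsum_ite {α : Type*} (e : α ≃ α) (g : α → ENNReal) (P : α → Prop)
    [DecidablePred P] (hP : ∀ x, P x ∨ P (e x)) (hg : ∀ x, g (e x) = g x) :
    ∑' x, g x ≤ 2 * ∑' x, if P x then g x else 0 := by
  calc ∑' x, g x ≤ ∑' x, ((if P x then g x else 0) + if P (e x) then g (e x) else 0) := by
        refine ENNReal.tsum_le_tsum fun x => ?_
        rw [hg]
        rcases hP x with h | h <;> simp [h]
    _ = 2 * ∑' x, if P x then g x else 0 := by
        rw [ENNReal.tsum_add, e.tsum_eq fun x => if P x then g x else 0, two_mul]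

/-- By symmetry, an additive energy of squares is controlled by its ordered solutions. -/
lemma tsum_sq_energy_le_ordered (b : ℕ → ENNReal) :
    (∑' z : (ℕ × ℕ) × (ℕ × ℕ), if z.1.1 ^ 2 + z.1.2 ^ 2 = z.2.1 ^ 2 + z.2.2 ^ 2 then
        b z.1.1 * b z.1.2 * (b z.2.1 * b z.2.2) else 0) ≤
      8 * ∑' z : (ℕ × ℕ) × (ℕ × ℕ), if z.2.1 ≤ z.1.1 ∧ z.2.2 ≤ z.2.1 ∧ z.1.2 ≤ z.1.1 ∧
        z.1.1 ^ 2 + z.1.2 ^ 2 = z.2.1 ^ 2 + z.2.2 ^ 2 then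
        b z.1.1 * b z.1.2 * (b z.2.1 * b z.2.2) else 0 := by
  have h1 := tsum_le_two_mul_tsum_ite
    (Equiv.prodCongr (Equiv.prodComm ℕ ℕ) (Equiv.refl (ℕ × ℕ)))
    (fun z : (ℕ × ℕ) × (ℕ × ℕ) => if z.1.1 ^ 2 + z.1.2 ^ 2 = z.2.1 ^ 2 + z.2.2 ^ 2 then
        b z.1.1 * b z.1.2 * (b z.2.1 * b z.2.2) else 0)
    (fun z => z.1.2 ≤ z.1.1) (fun z => le_total _ _)
    (fun z => by simp [add_comm, mul_comm])
  have h2 := tsum_le_two_mul_tsum_ite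
    (Equiv.prodCongr (Equiv.refl (ℕ × ℕ)) (Equiv.prodComm ℕ ℕ))
    (fun z : (ℕ × ℕ) × (ℕ × ℕ) => if z.1.2 ≤ z.1.1 then
      if z.1.1 ^ 2 + z.1.2 ^ 2 = z.2.1 ^ 2 + z.2.2 ^ 2 then
        b z.1.1 * b z.1.2 * (b z.2.1 * b z.2.2) else 0 else 0)
    (fun z => z.2.2 ≤ z.2.1) (fun z => le_total _ _)
    (fun z => by simp [add_comm, mul_comm])
  have h3 := tsum_le_two_mul_tsum_ite (Equiv.prodComm (ℕ × ℕ) (ℕ × ℕ))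
    (fun z : (ℕ × ℕ) × (ℕ × ℕ) => if z.2.2 ≤ z.2.1 then if z.1.2 ≤ z.1.1 then
      if z.1.1 ^ 2 + z.1.2 ^ 2 = z.2.1 ^ 2 + z.2.2 ^ 2 then
        b z.1.1 * b z.1.2 * (b z.2.1 * b z.2.2) else 0 else 0 else 0)
    (fun z => z.2.1 ≤ z.1.1) (fun z => le_total _ _)
    (fun z => by
      simp only [Equiv.prodComm_apply, Prod.fst_swap, Prod.snd_swap]
      rw [mul_comm (b z.2.1 * b z.2.2)]
      simp only [eq_comm (a := z.2.1 ^ 2 + z.2.2 ^ 2)]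
      split_ifs <;> rfl)
  simp only [← ite_and] at h1 h2 h3
  refine h1.trans ((mul_le_mul_right (h2.trans (mul_le_mul_right h3 _)) _).trans_eq ?_)
  rw [← mul_assoc, ← mul_assoc]
  norm_num

/-- A tail of `∑ 1 / n ^ 2`. -/
lemma tsum_tail_inv_sq_le {y : ℝ} (hy : 1 ≤ y) :
    (∑' n : ℕ, if y ≤ n then ENNReal.ofReal (1 / (n : ℝ) ^ 2) else 0) ≤
      ENNReal.ofReal (2 / y) := by
  have hceil : 1 ≤ ⌈y⌉₊ := Nat.one_le_ceil_iff.2 (by linarith)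
  refine ENNReal.tsum_le_of_sum_range_le fun K => ?_
  rw [← Finset.sum_filter, ← ENNReal.ofReal_sum_of_nonneg fun i _ => by positivity]
  refine ENNReal.ofReal_le_ofReal ?_
  have hsub : (Finset.range K).filter (fun n : ℕ => y ≤ n) ⊆ Finset.Ioo (⌈y⌉₊ - 1) K := by
    intro n hn
    rw [Finset.mem_filter, Finset.mem_range] at hn
    have := Nat.ceil_le.2 hn.2
    rw [Finset.mem_Ioo]
    omega
  calc ∑ n ∈ (Finset.range K).filter (fun n : ℕ => y ≤ n), 1 / (n : ℝ) ^ 2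
      ≤ ∑ n ∈ Finset.Ioo (⌈y⌉₊ - 1) K, ((n : ℝ) ^ 2)⁻¹ := by
        simp only [one_div]
        exact Finset.sum_le_sum_of_subset_of_nonneg hsub fun i _ _ => by positivity
    _ ≤ 2 / ((⌈y⌉₊ - 1 : ℕ) + 1) := sum_Ioo_inv_sq_le _ _
    _ ≤ 2 / y := by
        push_cast [hceil]
        gcongr
        linarith [Nat.le_ceil y]

/-- If `f n ≤ K / n ^ 2` for `n ≥ y` and `f` vanishes below `y`, then `∑ f ≤ 2 K / y`. -/
lemma tsum_le_of_le_inv_sq {y K : ℝ} (hy : 1 ≤ y) (hK : 0 ≤ K) (f : ℕ → ENNReal)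
    (hf : ∀ n : ℕ, f n ≤ if y ≤ n then ENNReal.ofReal (K / (n : ℝ) ^ 2) else 0) :
    ∑' n, f n ≤ ENNReal.ofReal (2 * K / y) := by
  calc ∑' n, f n
      ≤ ∑' n : ℕ, ENNReal.ofReal K * if y ≤ n then ENNReal.ofReal (1 / (n : ℝ) ^ 2) else 0 := by
        refine ENNReal.tsum_le_tsum fun n => (hf n).trans_eq ?_
        rw [mul_ite, mul_zero, ← ENNReal.ofReal_mul hK, mul_one_div]
    _ ≤ ENNReal.ofReal K * ENNReal.ofReal (2 / y) := by
        rw [ENNReal.tsum_mul_left]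
        gcongr
        exact tsum_tail_inv_sq_le hy
    _ = _ := by
        rw [← ENNReal.ofReal_mul hK]
        congr 1
        ring

lemma tsum_one_le_mul_le_le (c K : ℕ) (hc : 0 < c) (w : ℝ) (hw : 0 ≤ w) :
    (∑' a : ℕ, if 1 ≤ a ∧ a * c ≤ K then ENNReal.ofReal w else 0) ≤
      ENNReal.ofReal (K / c * w) := by
  rw [tsum_eq_sum (s := Finset.Icc 1 (K / c))]
  · calc _ ≤ ∑ a ∈ Finset.Icc 1 (K / c), ENNReal.ofReal w :=
          Finset.sum_le_sum fun a _ => by split_ifs <;> simp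
      _ = ENNReal.ofReal ((K / c : ℕ) * w) := by
          rw [Finset.sum_const, Nat.card_Icc, Nat.add_sub_cancel, nsmul_eq_mul,
            ENNReal.ofReal_mul (by positivity), ENNReal.ofReal_natCast]
      _ ≤ _ := ENNReal.ofReal_le_ofReal (by gcongr; exact Nat.cast_div_le)
  · intro a ha
    rw [if_neg]
    rintro ⟨h1, h2⟩
    exact ha (Finset.mem_Icc.2 ⟨h1, (Nat.le_div_iff_mul_le hc).2 h2⟩)

lemma tsum_inv_le_one_add_log {y : ℝ} (hy : 1 ≤ y) :
    (∑' d : ℕ, if 1 ≤ d ∧ (d : ℝ) ≤ y then ENNReal.ofReal (1 / (d : ℝ)) else 0) ≤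
      ENNReal.ofReal (1 + Real.log y) := by
  rw [tsum_eq_sum (s := Finset.Icc 1 ⌊y⌋₊)]
  · calc _ ≤ ∑ d ∈ Finset.Icc 1 ⌊y⌋₊, ENNReal.ofReal (1 / (d : ℝ)) :=
          Finset.sum_le_sum fun d _ => by split_ifs <;> simp
      _ = ENNReal.ofReal (harmonic ⌊y⌋₊ : ℚ) := by
          rw [← ENNReal.ofReal_sum_of_nonneg fun i _ => by positivity, harmonic_eq_sum_Icc]
          push_cast
          simp only [one_div]
      _ ≤ _ := ENNReal.ofReal_le_ofReal (harmonic_floor_le_one_add_log y hy)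
  · intro d hd
    rw [if_neg]
    rintro ⟨h1, h2⟩
    exact hd (Finset.mem_Icc.2 ⟨h1, Nat.le_floor h2⟩)

/-- The weight of a solution parametrised by `(d, b, c, a)`, with `x` the cutoff for `b * d`. -/
noncomputable def divisorWeight (x : ℝ) (t : ℕ × ℕ × ℕ × ℕ) : ENNReal :=
  if 1 ≤ t.1 ∧ 1 ≤ t.2.1 ∧ t.2.1 ≤ t.2.2.1 ∧ x ≤ t.2.1 * t.1 then
    if 1 ≤ t.2.2.2 ∧ t.2.2.2 * t.2.2.1 ≤ t.2.1 * t.1 then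
      ENNReal.ofReal (1 / (((t.2.2.1 : ℝ) * t.1) ^ 4 * ((t.2.1 : ℝ) * t.1) ^ 2))
    else 0
  else 0

lemma tsum_divisorWeight_le {x : ℝ} (hx : 1 ≤ x) :
    ∑' t, divisorWeight x t ≤ ENNReal.ofReal (4 * (3 + Real.log x) / x ^ 4) := by
  have hlog := Real.log_nonneg hx
  have ha : ∀ d b c : ℕ, ∑' a, divisorWeight x (d, b, c, a) ≤
      if 1 ≤ d ∧ 1 ≤ b ∧ b ≤ c ∧ x ≤ b * d then
        ENNReal.ofReal (1 / ((c : ℝ) ^ 5 * (d : ℝ) ^ 5 * b)) else 0 := by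
    intro d b c
    simp only [divisorWeight]
    split_ifs with h
    · obtain ⟨hd, hb, hbc, -⟩ := h
      have hd0 : (0 : ℝ) < d := by exact_mod_cast hd
      have hb0 : (0 : ℝ) < b := by exact_mod_cast hb
      have hc0 : (0 : ℝ) < c := by exact_mod_cast hb.trans hbc
      refine (tsum_one_le_mul_le_le c (b * d) (by omega) _ (by positivity)).trans_eq ?_
      congr 1
      push_cast
      field_simp
    · simp
  have hc : ∀ d b : ℕ, ∑' c, ∑' a, divisorWeight x (d, b, c, a) ≤
      if 1 ≤ d ∧ 1 ≤ b ∧ x ≤ b * d then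
        ENNReal.ofReal (2 / ((b : ℝ) ^ 5 * (d : ℝ) ^ 5)) else 0 := by
    intro d b
    refine (ENNReal.tsum_le_tsum fun c => ha d b c).trans ?_
    split_ifs with h
    · obtain ⟨hd, hb, hbd⟩ := h
      have hd0 : (0 : ℝ) < d := by exact_mod_cast hd
      have hb1 : (1 : ℝ) ≤ b := by exact_mod_cast hb
      have hb0 : (0 : ℝ) < b := by linarith
      refine (tsum_le_of_le_inv_sq (K := 1 / ((b : ℝ) ^ 4 * (d : ℝ) ^ 5)) hb1 (by positivity) _
        fun c => ?_).trans_eq ?_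
      · simp only [Nat.cast_le]
        by_cases hbc : b ≤ c
        · rw [if_pos ⟨hd, hb, hbc, hbd⟩, if_pos hbc]
          refine ENNReal.ofReal_le_ofReal ?_
          have hbc' : (b : ℝ) ≤ c := by exact_mod_cast hbc
          have hc0 : (0 : ℝ) < c := by linarith
          rw [div_div]
          refine one_div_le_one_div_of_le (by positivity) ?_
          calc (b : ℝ) ^ 4 * (d : ℝ) ^ 5 * (c : ℝ) ^ 2
              = (b : ℝ) ^ 3 * (d : ℝ) ^ 5 * (c : ℝ) ^ 2 * b := by ring
            _ ≤ (c : ℝ) ^ 3 * (d : ℝ) ^ 5 * (c : ℝ) ^ 2 * b := by gcongr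
            _ = _ := by ring
        · rw [if_neg hbc, if_neg fun h => hbc h.2.2.1]
      · congr 1
        field_simp
    · rw [ENNReal.tsum_eq_zero.2 fun c => if_neg fun h' => h ⟨h'.1, h'.2.1, h'.2.2.2⟩]
  have hb : ∀ d : ℕ, ∑' b, ∑' c, ∑' a, divisorWeight x (d, b, c, a) ≤
      if 1 ≤ d then
        ENNReal.ofReal (4 / ((d : ℝ) ^ 5 * (max 1 (x / d)) ^ 4)) else 0 := by
    intro d
    refine (ENNReal.tsum_le_tsum fun b => hc d b).trans ?_
    split_ifs with hd
    · have hd0 : (0 : ℝ) < d := by exact_mod_cast hd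
      set y := max 1 (x / d) with hy
      have hy1 : 1 ≤ y := le_max_left _ _
      have hy0 : 0 < y := by linarith
      refine (tsum_le_of_le_inv_sq (K := 2 / (y ^ 3 * (d : ℝ) ^ 5)) hy1 (by positivity) _
        fun b => ?_).trans_eq ?_
      · by_cases hbd : 1 ≤ b ∧ x ≤ b * d
        · have hyb : y ≤ b := max_le (by exact_mod_cast hbd.1) ((div_le_iff₀ hd0).2 hbd.2)
          have hb0 : (0 : ℝ) < b := by linarith
          rw [if_pos ⟨hd, hbd⟩, if_pos hyb]
          refine ENNReal.ofReal_le_ofReal ?_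
          rw [div_div]
          refine div_le_div_of_nonneg_left (by norm_num) (by positivity) ?_
          calc y ^ 3 * (d : ℝ) ^ 5 * (b : ℝ) ^ 2
              ≤ (b : ℝ) ^ 3 * (d : ℝ) ^ 5 * (b : ℝ) ^ 2 := by gcongr
            _ = _ := by ring
        · rw [if_neg fun h => hbd h.2]
          exact zero_le
      · congr 1
        field_simp
        norm_num
    · rw [ENNReal.tsum_eq_zero.2 fun b => if_neg fun h' => hd h'.1]
  have hd : ∀ d : ℕ, (if 1 ≤ d then
        ENNReal.ofReal (4 / ((d : ℝ) ^ 5 * (max 1 (x / d)) ^ 4)) else 0) ≤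
      ENNReal.ofReal (4 / x ^ 4) *
          (if 1 ≤ d ∧ (d : ℝ) ≤ x then ENNReal.ofReal (1 / (d : ℝ)) else 0) +
        ENNReal.ofReal (4 / x ^ 3) *
          (if x ≤ d then ENNReal.ofReal (1 / (d : ℝ) ^ 2) else 0) := by
    intro d
    by_cases hd : 1 ≤ d
    · have hd0 : (0 : ℝ) < d := by exact_mod_cast hd
      rw [if_pos hd]
      rcases le_total (d : ℝ) x with hdx | hxd
      · refine le_add_right ?_
        rw [if_pos ⟨hd, hdx⟩, ← ENNReal.ofReal_mul (by positivity),
          max_eq_right ((one_le_div hd0).2 hdx)]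
        refine ENNReal.ofReal_le_ofReal (le_of_eq ?_)
        field_simp
      · refine le_add_left ?_
        rw [if_pos hxd, ← ENNReal.ofReal_mul (by positivity),
          max_eq_left ((div_le_one hd0).2 hxd), div_mul_div_comm, mul_one, one_pow, mul_one]
        refine ENNReal.ofReal_le_ofReal
          (div_le_div_of_nonneg_left (by norm_num) (by positivity) ?_)
        calc x ^ 3 * (d : ℝ) ^ 2 ≤ (d : ℝ) ^ 3 * (d : ℝ) ^ 2 := by gcongr
          _ = _ := by ring
    · rw [if_neg hd]
      exact zero_le
  calc ∑' t, divisorWeight x t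
      = ∑' d, ∑' b, ∑' c, ∑' a, divisorWeight x (d, b, c, a) := by
        simp only [ENNReal.tsum_prod']
    _ ≤ ENNReal.ofReal (4 / x ^ 4) * ENNReal.ofReal (1 + Real.log x) +
        ENNReal.ofReal (4 / x ^ 3) * ENNReal.ofReal (2 / x) := by
        refine (ENNReal.tsum_le_tsum fun d => (hb d).trans (hd d)).trans ?_
        rw [ENNReal.tsum_add, ENNReal.tsum_mul_left, ENNReal.tsum_mul_left]
        gcongr
        · exact tsum_inv_le_one_add_log hx
        · exact tsum_tail_inv_sq_le hx
    _ = _ := by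
        have hx0 : 0 < x := by linarith
        rw [← ENNReal.ofReal_mul (by positivity), ← ENNReal.ofReal_mul (by positivity),
          ← ENNReal.ofReal_add (by positivity) (by positivity)]
        congr 1
        field_simp
        ring

/-- Factorisation of the nontrivial ordered solutions of `n₁ ^ 2 + n₂ ^ 2 = n₃ ^ 2 + n₄ ^ 2`. -/
lemma exists_factorization_of_sq_add_sq_eq {n₁ n₂ n₃ n₄ : ℕ} (h31 : n₃ < n₁) (h43 : n₄ ≤ n₃)
    (h2 : 0 < n₂) (h : n₁ ^ 2 + n₂ ^ 2 = n₃ ^ 2 + n₄ ^ 2) :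
    ∃ d b c a : ℕ, 1 ≤ d ∧ 1 ≤ b ∧ b ≤ c ∧ 1 ≤ a ∧ n₁ = n₃ + a * b ∧ n₁ + n₃ = c * d ∧
      n₄ = n₂ + a * c ∧ n₄ + n₂ = b * d := by
  have h24 : n₂ < n₄ := by
    by_contra! hle
    nlinarith
  obtain ⟨x, rfl⟩ := Nat.exists_eq_add_of_lt h31
  obtain ⟨z, rfl⟩ := Nat.exists_eq_add_of_lt h24
  have hprod : (x + 1) * (2 * n₃ + (x + 1)) = (z + 1) * (2 * n₂ + (z + 1)) := by nlinarith
  obtain ⟨a, b, ⟨c, hc⟩, ⟨d, hd⟩, hab⟩ := exists_dvd_and_dvd_of_dvd_mul (Dvd.intro _ hprod)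
  have ha0 : 0 < a := Nat.pos_of_ne_zero (by rintro rfl; simp at hab)
  have hb0 : 0 < b := Nat.pos_of_ne_zero (by rintro rfl; simp at hab)
  have hd0 : 0 < d := Nat.pos_of_ne_zero (by rintro rfl; omega)
  have hcd : 2 * n₃ + (x + 1) = c * d := by
    rw [hd, hc] at hprod
    nth_rewrite 1 [hab] at hprod
    refine Nat.eq_of_mul_eq_mul_left (Nat.mul_pos ha0 hb0) ?_
    linarith
  refine ⟨d, b, c, a, hd0, hb0, ?_, ha0, by omega, by omega, by omega, by omega⟩
  refine Nat.le_of_mul_le_mul_right (c := d) ?_ hd0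
  omega

/-- The sequence `1 / n ^ 2` restricted to `n > N`. -/
noncomputable def tailInvSq (N : ℝ) (n : ℕ) : ENNReal :=
  if N < n then ENNReal.ofReal (1 / (n : ℝ) ^ 2) else 0

lemma tsum_tailInvSq_sq_le {N : ℝ} (hN : 1 ≤ N) :
    ∑' n, tailInvSq N n * tailInvSq N n ≤ ENNReal.ofReal (2 / N ^ 3) := by
  have hN0 : 0 < N := by linarith
  refine (tsum_le_of_le_inv_sq (K := 1 / N ^ 2) hN (by positivity) _ fun n => ?_).trans_eq ?_
  · by_cases h : N < n
    · rw [tailInvSq, if_pos h, if_pos h.le, ← ENNReal.ofReal_mul (by positivity)]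
      refine ENNReal.ofReal_le_ofReal ?_
      rw [div_eq_mul_one_div (1 / N ^ 2)]
      gcongr
    · simp [tailInvSq, h]
  · congr 1
    field_simp

/-- The nontrivial ordered solutions with all entries larger than `N`. -/
def offDiagonalSolutions (N : ℝ) : Set ((ℕ × ℕ) × (ℕ × ℕ)) :=
  {z | z.2.1 < z.1.1 ∧ z.2.2 ≤ z.2.1 ∧ N < z.1.2 ∧
    z.1.1 ^ 2 + z.1.2 ^ 2 = z.2.1 ^ 2 + z.2.2 ^ 2}

lemma tsum_offDiagonalSolutions_le {N : ℝ} (hN : 1 ≤ N) :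
    (∑' z : offDiagonalSolutions N, ENNReal.ofReal
      (1 / ((z.1.1.1 : ℝ) * z.1.1.2 * (z.1.2.1 * z.1.2.2)) ^ 2)) ≤
      ENNReal.ofReal (64 * (3 + Real.log (2 * N)) / N ^ 6) := by
  have hN0 : 0 < N := by linarith
  have hpar : ∀ z : offDiagonalSolutions N, ∃ t : ℕ × ℕ × ℕ × ℕ,
      1 ≤ t.1 ∧ 1 ≤ t.2.1 ∧ t.2.1 ≤ t.2.2.1 ∧ 1 ≤ t.2.2.2 ∧
      z.1.1.1 = z.1.2.1 + t.2.2.2 * t.2.1 ∧ z.1.1.1 + z.1.2.1 = t.2.2.1 * t.1 ∧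
      z.1.2.2 = z.1.1.2 + t.2.2.2 * t.2.2.1 ∧ z.1.2.2 + z.1.1.2 = t.2.1 * t.1 := by
    rintro ⟨z, h31, h43, h2, h⟩
    have h2' : 0 < z.1.2 := by exact_mod_cast hN0.trans h2
    obtain ⟨d, b, c, a, H⟩ := exists_factorization_of_sq_add_sq_eq h31 h43 h2' h
    exact ⟨(d, b, c, a), H⟩
  choose f hf using hpar
  have hinj : Function.Injective f := by
    intro z w hzw
    obtain ⟨-, -, -, -, h1, h2, h3, h4⟩ := hf z
    obtain ⟨-, -, -, -, k1, k2, k3, k4⟩ := hf w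
    rw [← hzw] at k1 k2 k3 k4
    ext <;> omega
  have hle : ∀ z : offDiagonalSolutions N, ENNReal.ofReal
      (1 / ((z.1.1.1 : ℝ) * z.1.1.2 * (z.1.2.1 * z.1.2.2)) ^ 2) ≤
      ENNReal.ofReal (256 / N ^ 2) * divisorWeight (2 * N) (f z) := by
    intro z
    obtain ⟨hd, hb, hbc, ha, h1, h2, h3, h4⟩ := hf z
    obtain ⟨h31, h43, hN2, heq⟩ := z.2
    generalize f z = t at *
    obtain ⟨d, b, c, a⟩ := t
    obtain ⟨⟨⟨n₁, n₂⟩, ⟨n₃, n₄⟩⟩, hz⟩ := z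
    simp only at *
    have hac : a * c ≤ b * d := by omega
    have h2' : (n₁ : ℝ) + n₃ = c * d := by exact_mod_cast h2
    have h4' : (n₄ : ℝ) + n₂ = b * d := by exact_mod_cast h4
    have h31' : (n₃ : ℝ) ≤ n₁ := by exact_mod_cast h31.le
    have h24' : (n₂ : ℝ) ≤ n₄ := by exact_mod_cast (show n₂ ≤ n₄ by omega)
    have h13 : n₁ ≤ 2 * n₃ := by nlinarith
    have h13' : (n₁ : ℝ) ≤ 2 * n₃ := by exact_mod_cast h13
    have hd0 : (0 : ℝ) < d := by exact_mod_cast hd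
    have hb0 : (0 : ℝ) < b := by exact_mod_cast hb
    have hc0 : (0 : ℝ) < c := by exact_mod_cast hb.trans hbc
    have hx : 2 * N ≤ (b : ℝ) * d := by linarith
    rw [divisorWeight, if_pos ⟨hd, hb, hbc, hx⟩, if_pos ⟨ha, hac⟩,
      ← ENNReal.ofReal_mul (by positivity)]
    refine ENNReal.ofReal_le_ofReal ?_
    have e1 : (c : ℝ) * d / 2 ≤ n₁ := by linarith
    have e3 : (c : ℝ) * d / 4 ≤ n₃ := by linarith
    have e4 : (b : ℝ) * d / 2 ≤ n₄ := by linarith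
    calc 1 / ((n₁ : ℝ) * n₂ * (n₃ * n₄)) ^ 2
        ≤ 1 / ((c : ℝ) * d / 2 * N * (c * d / 4 * (b * d / 2))) ^ 2 := by gcongr
      _ = _ := by field_simp; norm_num
  calc _ ≤ ∑' z : offDiagonalSolutions N,
        ENNReal.ofReal (256 / N ^ 2) * divisorWeight (2 * N) (f z) := ENNReal.tsum_le_tsum hle
    _ ≤ ENNReal.ofReal (256 / N ^ 2) *
        ENNReal.ofReal (4 * (3 + Real.log (2 * N)) / (2 * N) ^ 4) := by
        rw [ENNReal.tsum_mul_left]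
        gcongr
        exact (ENNReal.tsum_comp_le_tsum_of_injective hinj _).trans
          (tsum_divisorWeight_le (by linarith))
    _ = _ := by
        rw [← ENNReal.ofReal_mul (by positivity)]
        congr 1
        field_simp
        ring

lemma tsum_sq_energy_tailInvSq_le {N : ℝ} (hN : 1 ≤ N) :
    (∑' z : (ℕ × ℕ) × (ℕ × ℕ), if z.1.1 ^ 2 + z.1.2 ^ 2 = z.2.1 ^ 2 + z.2.2 ^ 2 then
        tailInvSq N z.1.1 * tailInvSq N z.1.2 * (tailInvSq N z.2.1 * tailInvSq N z.2.2) else 0) ≤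
      ENNReal.ofReal (8 * (4 + 64 * (3 + Real.log (2 * N))) / N ^ 6) := by
  have hN0 : 0 < N := by linarith
  have hlog := Real.log_nonneg (show 1 ≤ 2 * N by linarith)
  set b := tailInvSq N with hb
  set g : (ℕ × ℕ) × (ℕ × ℕ) → ENNReal := fun z => ENNReal.ofReal
      (1 / ((z.1.1 : ℝ) * z.1.2 * (z.2.1 * z.2.2)) ^ 2) with hg
  have hsplit : ∀ z : (ℕ × ℕ) × (ℕ × ℕ), (if z.2.1 ≤ z.1.1 ∧ z.2.2 ≤ z.2.1 ∧ z.1.2 ≤ z.1.1 ∧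
      z.1.1 ^ 2 + z.1.2 ^ 2 = z.2.1 ^ 2 + z.2.2 ^ 2 then
        b z.1.1 * b z.1.2 * (b z.2.1 * b z.2.2) else 0) ≤
      (if z.2 = z.1 then b z.1.1 * b z.1.2 * (b z.1.1 * b z.1.2) else 0) +
        (offDiagonalSolutions N).indicator g z := by
    intro z
    split_ifs with h hz hz
    · rw [hz]
      exact le_self_add
    · obtain ⟨h31, h43, h21, heq⟩ := h
      have hlt : z.2.1 < z.1.1 := by
        refine lt_of_le_of_ne h31 fun h31' => hz ?_
        have : z.2.2 ^ 2 = z.1.2 ^ 2 := by rw [h31'] at heq; omega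
        exact Prod.ext h31' (Nat.pow_left_injective two_ne_zero this)
      refine le_add_left ?_
      by_cases hN2 : N < z.1.2
      · rw [Set.indicator_of_mem (show z ∈ offDiagonalSolutions N from ⟨hlt, h43, hN2, heq⟩)]
        have hle : ∀ n, b n ≤ ENNReal.ofReal (1 / (n : ℝ) ^ 2) := fun n => by
          rw [hb, tailInvSq]
          split_ifs
          · exact le_rfl
          · exact zero_le
        calc _ ≤ ENNReal.ofReal (1 / (z.1.1 : ℝ) ^ 2) * ENNReal.ofReal (1 / (z.1.2 : ℝ) ^ 2) *
              (ENNReal.ofReal (1 / (z.2.1 : ℝ) ^ 2) * ENNReal.ofReal (1 / (z.2.2 : ℝ) ^ 2)) :=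
              mul_le_mul' (mul_le_mul' (hle _) (hle _)) (mul_le_mul' (hle _) (hle _))
          _ = g z := by
              rw [← ENNReal.ofReal_mul (by positivity), ← ENNReal.ofReal_mul (by positivity),
                ← ENNReal.ofReal_mul (by positivity)]
              simp only [hg, mul_pow, one_div, mul_inv]
      · have : b z.1.2 = 0 := by rw [hb, tailInvSq, if_neg hN2]
        simp [this]
    · exact zero_le
    · exact zero_le
  have hdiag : (∑' z : (ℕ × ℕ) × (ℕ × ℕ),
      if z.2 = z.1 then b z.1.1 * b z.1.2 * (b z.1.1 * b z.1.2) else 0) ≤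
      ENNReal.ofReal (4 / N ^ 6) := by
    rw [ENNReal.tsum_prod']
    simp only [tsum_ite_eq]
    rw [ENNReal.tsum_prod']
    have : ∀ m n, b m * b n * (b m * b n) = b m * b m * (b n * b n) := fun m n => by ring
    simp only [this, ENNReal.tsum_mul_left, ENNReal.tsum_mul_right]
    refine (mul_le_mul' (tsum_tailInvSq_sq_le hN) (tsum_tailInvSq_sq_le hN)).trans_eq ?_
    rw [← ENNReal.ofReal_mul (by positivity)]
    congr 1
    field_simp
    norm_num
  refine (tsum_sq_energy_le_ordered b).trans ?_
  calc _ ≤ 8 * (ENNReal.ofReal (4 / N ^ 6) +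
        ENNReal.ofReal (64 * (3 + Real.log (2 * N)) / N ^ 6)) := by
        gcongr
        refine (ENNReal.tsum_le_tsum hsplit).trans ?_
        rw [ENNReal.tsum_add, ← tsum_subtype]
        exact add_le_add hdiag (tsum_offDiagonalSolutions_le hN)
    _ = _ := by
        rw [← ENNReal.ofReal_add (by positivity) (by positivity),
          show (8 : ENNReal) = ENNReal.ofReal 8 by norm_num, ← ENNReal.ofReal_mul (by norm_num)]
        congr 1
        ring

/-- The high-pass filtered increment as a series over the integers instead of their squares. -/
lemma incrementHigh_eq_tsum_sq (M ℓ x : ℝ) :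
    incrementHigh M ℓ x = 2 * Complex.I * ∑' n : ℕ,
      (if M < ((n ^ 2 : ℕ) : ℝ) then
        ((Real.sin (Real.pi * ((n ^ 2 : ℕ) : ℝ) * ℓ) / ((n ^ 2 : ℕ) : ℝ) : ℝ) : ℂ) else 0) *
        eChar (n ^ 2) x := by
  have hinj : Function.Injective fun n : ℕ => n ^ 2 := Nat.pow_left_injective two_ne_zero
  rw [incrementHigh, ← hinj.tsum_eq]
  · congr 1
    refine tsum_congr fun n => ?_
    have : sqIndicator (n ^ 2) = 1 := if_pos (IsSquare.sq n)
    rw [this, mul_one, ite_mul, zero_mul]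
  · intro k hk
    by_contra hsq
    refine hk ?_
    have : sqIndicator k = 0 := if_neg fun ⟨r, hr⟩ => hsq ⟨r, by simp [hr, sq]⟩
    simp [this]

/-- There exist `C > 0` and `ℓ₀ ∈ (0,1/2)` such that for every `0 < ℓ < ℓ₀`,
`‖I_{>ℓ⁻¹/2}(ℓ)‖_{L⁴(𝕋)}⁴ ≤ C · ℓ³ · log(ℓ⁻¹)`. -/
theorem riemann_increment_high_L4 :
    ∃ C ℓ₀ : ℝ, 0 < C ∧ 0 < ℓ₀ ∧ ℓ₀ < 1/2 ∧
      ∀ ℓ : ℝ, 0 < ℓ → ℓ < ℓ₀ →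
        (∫ x in (0:ℝ)..1, ‖incrementHigh (ℓ⁻¹ / 2) ℓ x‖ ^ 4) ≤
          C * ℓ ^ 3 * Real.log ℓ⁻¹ := by
  refine ⟨16 * (8 * 260 * 8), 1 / 4, by norm_num, by norm_num, by norm_num, fun ℓ hℓ hℓ4 => ?_⟩
  have hinv : 4 ≤ ℓ⁻¹ := by
    rw [le_inv_comm₀ (by norm_num) hℓ]
    linarith
  set M := ℓ⁻¹ / 2 with hM
  set N := Real.sqrt M with hN
  have hN2 : N ^ 2 = M := Real.sq_sqrt (by linarith)
  have hN1 : 1 ≤ N := Real.one_le_sqrt.2 (by linarith)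
  have hN0 : 0 < N := by linarith
  set a : ℕ → ℂ := fun n => if M < ((n ^ 2 : ℕ) : ℝ) then
    ((Real.sin (Real.pi * ((n ^ 2 : ℕ) : ℝ) * ℓ) / ((n ^ 2 : ℕ) : ℝ) : ℝ) : ℂ) else 0 with ha
  have hnorm : ∀ n, ‖a n‖ ≤ if N < n then 1 / (n : ℝ) ^ 2 else 0 := by
    intro n
    have hiff : M < ((n ^ 2 : ℕ) : ℝ) ↔ N < n := by
      rw [← hN2, Nat.cast_pow, sq_lt_sq₀ hN0.le (Nat.cast_nonneg n)]
    simp only [ha, hiff]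
    split_ifs
    · rw [Complex.norm_real, norm_div, Nat.cast_pow, Real.norm_of_nonneg (sq_nonneg (n : ℝ))]
      gcongr
      exact Real.abs_sin_le_one _
    · simp
  have hsum : Summable fun n => ‖a n‖ := by
    refine (Real.summable_one_div_nat_pow.2 one_lt_two).of_nonneg_of_le (fun n => norm_nonneg _)
      fun n => (hnorm n).trans ?_
    split_ifs
    · exact le_rfl
    · positivity
  have henorm : ∀ n, ‖a n‖ₑ ≤ tailInvSq N n := by
    intro n
    rw [← ofReal_norm, tailInvSq]
    refine (ENNReal.ofReal_le_ofReal (hnorm n)).trans_eq ?_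
    split_ifs <;> simp
  have henergy : ∫ x in (0 : ℝ)..1, ‖∑' n, a n * eChar (n ^ 2) x‖ ^ 4 ≤
      8 * (4 + 64 * (3 + Real.log (2 * N))) / N ^ 6 := by
    have hlog := Real.log_nonneg (show 1 ≤ 2 * N by linarith)
    rw [← ENNReal.ofReal_le_ofReal_iff (by positivity)]
    refine (ofReal_integral_norm_tsum_pow_four_le a (fun n => n ^ 2) hsum).trans
      (le_trans (ENNReal.tsum_le_tsum fun z => ?_) (tsum_sq_energy_tailInvSq_le hN1))
    split_ifs
    · exact mul_le_mul' (mul_le_mul' (henorm _) (henorm _)) (mul_le_mul' (henorm _) (henorm _))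
    · exact le_rfl
  have hlog1 : 1 ≤ Real.log ℓ⁻¹ := by
    rw [Real.le_log_iff_exp_le (by positivity)]
    linarith [Real.exp_one_lt_d9]
  have hlog2 : Real.log (2 * N) ≤ Real.log ℓ⁻¹ := by
    refine Real.log_le_log (by positivity) ?_
    refine le_of_sq_le_sq ?_ (by positivity)
    rw [mul_pow, hN2, hM]
    nlinarith
  have hN6 : N ^ 6 = 1 / (8 * ℓ ^ 3) := by
    rw [show N ^ 6 = (N ^ 2) ^ 3 by ring, hN2, hM]
    field_simp
    norm_num
  calc ∫ x in (0 : ℝ)..1, ‖incrementHigh M ℓ x‖ ^ 4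
      = 16 * ∫ x in (0 : ℝ)..1, ‖∑' n, a n * eChar (n ^ 2) x‖ ^ 4 := by
        rw [← intervalIntegral.integral_const_mul]
        congr 1
        funext x
        rw [incrementHigh_eq_tsum_sq, norm_mul, mul_pow,
          show ‖2 * Complex.I‖ ^ 4 = 16 by norm_num]
    _ ≤ 16 * (8 * (4 + 64 * (3 + Real.log (2 * N))) / N ^ 6) := by gcongr
    _ ≤ 16 * (8 * (260 * Real.log ℓ⁻¹) / N ^ 6) := by
        gcongr
        linarith
    _ = 16 * (8 * 260 * 8) * ℓ ^ 3 * Real.log ℓ⁻¹ := by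
        rw [hN6]
        field_simp
end

section
/- For every p > 0 there exist M_p > 1 and constants C_p > c_p > 0 such that for every integer N > M_p, c_p · ψ_p(N) ≤ ∫₀¹ |∑_{m=1}^N e^{2πim²x}|^p dx ≤ C_p · ψ_p(N), where ψ_p(N) = N^{p/2} if p < 4, ψ_p(N) = N² log N if p = 4, and ψ_p(N) = N^{p−2} if p > 4. -/
open Real MeasureTheory

/-- The quadratic Weyl sum `f_N(x) = ∑_{m=1}^N e^{2πim²x}`. -/
noncomputable def weylSum (N : ℕ) (x : ℝ) : ℂ :=
  ∑ m ∈ Finset.Icc 1 N, Complex.exp (2 * Real.pi * Complex.I * (m : ℂ) ^ 2 * (x : ℂ))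

/-- `ψ_p(N)`: `N^{p/2}` if `p < 4`, `N² log N` if `p = 4`, `N^{p-2}` if `p > 4`. -/
noncomputable def zalcPsi (p : ℝ) (N : ℕ) : ℝ :=
  if p < 4 then (N : ℝ) ^ (p / 2)
  else if p = 4 then (N : ℝ) ^ 2 * Real.log N
  else (N : ℝ) ^ (p - 2)

/-- The additive character `t ↦ e^{2πit}`. -/
noncomputable def unitPhase (t : ℝ) : ℂ := Complex.exp (2 * π * t * Complex.I)

lemma unitPhase_add (s t : ℝ) : unitPhase (s + t) = unitPhase s * unitPhase t := by
  rw [unitPhase, unitPhase, unitPhase, ← Complex.exp_add]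
  congr 1; push_cast; ring

lemma norm_unitPhase (t : ℝ) : ‖unitPhase t‖ = 1 := by
  have h := Complex.norm_exp_ofReal_mul_I (2 * π * t)
  push_cast at h
  exact h

lemma unitPhase_zero : unitPhase 0 = 1 := by simp [unitPhase]

lemma unitPhase_int (n : ℤ) : unitPhase n = 1 := by
  rw [unitPhase, Complex.exp_eq_one_iff]
  exact ⟨n, by push_cast; ring⟩

lemma conj_unitPhase (t : ℝ) : (starRingEnd ℂ) (unitPhase t) = unitPhase (-t) := by
  rw [unitPhase, unitPhase, ← Complex.exp_conj]
  congr 1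
  simp [Complex.conj_ofNat]

lemma unitPhase_nat_mul (j : ℕ) (t : ℝ) : unitPhase (j * t) = unitPhase t ^ j := by
  rw [unitPhase, unitPhase, ← Complex.exp_nat_mul]
  congr 1; push_cast; ring

lemma continuous_unitPhase : Continuous unitPhase := by
  unfold unitPhase; fun_prop

/-- The geometric sum `∑_{j<M} e^{2πijθ}`. -/
noncomputable def geomPhase (M : ℕ) (θ : ℝ) : ℂ := ∑ j ∈ Finset.range M, unitPhase (j * θ)

lemma norm_geomPhase_le (M : ℕ) (θ : ℝ) : ‖geomPhase M θ‖ ≤ M := by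
  refine (norm_sum_le _ _).trans ?_
  simp [norm_unitPhase]

lemma four_mul_le_norm_unitPhase_sub_one {δ θ : ℝ} (h : ∀ n : ℤ, δ ≤ |θ - n|) :
    4 * δ ≤ ‖unitPhase θ - 1‖ := by
  set t := θ - round θ with ht
  have hθ : unitPhase θ = unitPhase t := by
    have h1 : θ = t + (round θ : ℤ) := by rw [ht]; ring
    conv_lhs => rw [h1]
    rw [unitPhase_add, unitPhase_int, mul_one]
  have ht2 : |t| ≤ 1 / 2 := abs_sub_round θ
  have h3 := Complex.norm_exp_I_mul_ofReal_sub_one (2 * π * t)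
  have h4 : Complex.exp (Complex.I * ((2 * π * t : ℝ) : ℂ)) = unitPhase t := by
    rw [unitPhase]; congr 1; push_cast; ring
  rw [h4] at h3
  rw [hθ, h3, norm_mul, Real.norm_eq_abs, Real.norm_eq_abs, abs_two,
    show 2 * π * t / 2 = π * t by ring]
  have h5 : |Real.sin (π * t)| = Real.sin (π * |t|) := by
    rcases abs_cases t with ⟨h6, h7⟩ | ⟨h6, h7⟩
    · rw [h6, abs_of_nonneg]
      apply Real.sin_nonneg_of_nonneg_of_le_pi
      · positivity
      · nlinarith [Real.pi_pos]
    · rw [h6, mul_neg, Real.sin_neg, abs_of_nonpos]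
      rw [← neg_nonneg, ← Real.sin_neg]
      apply Real.sin_nonneg_of_nonneg_of_le_pi <;> nlinarith [Real.pi_pos]
  have h6 := Real.mul_le_sin (x := π * |t|) (by positivity) (by nlinarith [Real.pi_pos])
  have h7 : 2 / π * (π * |t|) = 2 * |t| := by
    have := Real.pi_pos.ne'
    field_simp
  have h8 : δ ≤ |t| := h _
  rw [h5]
  linarith

lemma norm_geomPhase_le_of_forall_int {δ θ : ℝ} (hδ : 0 < δ) (h : ∀ n : ℤ, δ ≤ |θ - n|) (M : ℕ) :
    ‖geomPhase M θ‖ ≤ 1 / (2 * δ) := by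
  have h1 := four_mul_le_norm_unitPhase_sub_one h
  have hne : unitPhase θ ≠ 1 := by
    intro h2
    rw [h2, sub_self, norm_zero] at h1
    linarith
  have h2 : geomPhase M θ = (unitPhase θ ^ M - 1) / (unitPhase θ - 1) := by
    rw [← geom_sum_eq hne, geomPhase]
    simp only [unitPhase_nat_mul]
  have h3 : ‖unitPhase θ ^ M - 1‖ ≤ 2 := by
    refine (norm_sub_le _ _).trans ?_
    rw [norm_pow, norm_unitPhase]
    norm_num
  rw [h2, norm_div, div_le_div_iff₀ (by linarith) (by linarith)]
  nlinarith

lemma sum_range_sum_range_eq_sum_diagonals {A : Type*} [AddCommMonoid A] (F : ℕ → ℕ → A) (K : ℕ) :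
    ∑ j ∈ Finset.range K, ∑ i ∈ Finset.range (j + 1), F j i =
      ∑ h ∈ Finset.range K, ∑ j ∈ Finset.range (K - h), F (j + h) j := by
  rw [← Finset.sum_range_diag_flip K (fun h j => F (j + h) j)]
  refine Finset.sum_congr rfl fun m _ => ?_
  rw [← Finset.sum_flip]
  refine Finset.sum_congr rfl fun k hk => ?_
  have : k ≤ m := Nat.lt_succ_iff.mp (Finset.mem_range.mp hk)
  rw [Nat.sub_add_cancel]
  exact this

lemma norm_sum_range_sum_range_le (F : ℕ → ℕ → ℂ) (K : ℕ)
    (hF : ∀ i j, F i j = (starRingEnd ℂ) (F j i)) :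
    ‖∑ j ∈ Finset.range K, ∑ i ∈ Finset.range K, F j i‖ ≤
      3 * ∑ h ∈ Finset.range K, ‖∑ j ∈ Finset.range (K - h), F (j + h) j‖ := by
  have hsplit : ∀ n, ∑ j ∈ Finset.range n, ∑ i ∈ Finset.range n, F j i =
      ∑ j ∈ Finset.range n, ∑ i ∈ Finset.range (j + 1), F j i +
      ((starRingEnd ℂ) (∑ j ∈ Finset.range n, ∑ i ∈ Finset.range (j + 1), F j i) -
        ∑ j ∈ Finset.range n, F j j) := by
    intro n
    induction n with
    | zero => simp
    | succ n ih =>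
      have h1 : ∑ j ∈ Finset.range n, F j n = (starRingEnd ℂ) (∑ j ∈ Finset.range n, F n j) := by
        rw [map_sum]
        exact Finset.sum_congr rfl fun j _ => hF j n
      have h2 := hF n n
      simp only [Finset.sum_range_succ _ n]
      rw [Finset.sum_add_distrib, ih, h1, map_add, map_add, ← h2]
      ring
  have hlow : ‖∑ j ∈ Finset.range K, ∑ i ∈ Finset.range (j + 1), F j i‖ ≤
      ∑ h ∈ Finset.range K, ‖∑ j ∈ Finset.range (K - h), F (j + h) j‖ := by
    rw [sum_range_sum_range_eq_sum_diagonals]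
    exact norm_sum_le _ _
  have hdiag : ‖∑ j ∈ Finset.range K, F j j‖ ≤
      ∑ h ∈ Finset.range K, ‖∑ j ∈ Finset.range (K - h), F (j + h) j‖ := by
    rcases Nat.eq_zero_or_pos K with rfl | hK
    · simp
    · exact Finset.single_le_sum
        (f := fun h => ‖∑ j ∈ Finset.range (K - h), F (j + h) j‖)
        (fun _ _ => norm_nonneg _) (Finset.mem_range.mpr hK)
  rw [hsplit K]
  refine (norm_add_le _ _).trans ?_
  have h2 := norm_sub_le ((starRingEnd ℂ) (∑ j ∈ Finset.range K, ∑ i ∈ Finset.range (j + 1), F j i))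
    (∑ j ∈ Finset.range K, F j j)
  rw [RCLike.norm_conj] at h2
  linarith

/-- The quadratic exponential sum with tent weight
`K⁻¹ ∑_{i,j<K} e^{2πi(a+i+j)²x}`. -/
noncomputable def tentSum (K : ℕ) (a x : ℝ) : ℂ :=
  (K : ℂ)⁻¹ * ∑ i ∈ Finset.range K, ∑ j ∈ Finset.range K, unitPhase ((a + i + j) ^ 2 * x)

lemma norm_tentSum_sq_le {K : ℕ} (hK : 0 < K) (a x : ℝ) :
    ‖tentSum K a x‖ ^ 2 ≤ 3 * (K : ℝ)⁻¹ * ∑ h ∈ Finset.range K,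
      ‖geomPhase (K - h) ((2 * h : ℕ) * x)‖ * ‖geomPhase K ((2 * h : ℕ) * x)‖ := by
  have hK' : (0 : ℝ) < K := Nat.cast_pos.mpr hK
  set S : ℕ → ℂ := fun i => ∑ j ∈ Finset.range K, unitPhase ((a + i + j) ^ 2 * x) with hS
  set F : ℕ → ℕ → ℂ := fun j j' => ∑ i ∈ Finset.range K,
    unitPhase ((a + i + j) ^ 2 * x) * unitPhase (-((a + i + j') ^ 2 * x)) with hF
  have h1 : ‖tentSum K a x‖ ^ 2 ≤ (K : ℝ)⁻¹ * ∑ i ∈ Finset.range K, ‖S i‖ ^ 2 := by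
    have h2 : ‖∑ i ∈ Finset.range K, S i‖ ^ 2 ≤ K * ∑ i ∈ Finset.range K, ‖S i‖ ^ 2 := by
      refine (pow_le_pow_left₀ (norm_nonneg _) (norm_sum_le _ _) 2).trans ?_
      refine sq_sum_le_card_mul_sum_sq.trans ?_
      rw [Finset.card_range]
    rw [tentSum, norm_mul, mul_pow, norm_inv, Complex.norm_natCast, inv_pow, inv_mul_le_iff₀ (by positivity)]
    refine h2.trans (le_of_eq ?_)
    field_simp
  have h2 : ((∑ i ∈ Finset.range K, ‖S i‖ ^ 2 : ℝ) : ℂ) =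
      ∑ j ∈ Finset.range K, ∑ j' ∈ Finset.range K, F j j' := by
    have h3 : ∀ i, ((‖S i‖ ^ 2 : ℝ) : ℂ) = ∑ j ∈ Finset.range K, ∑ j' ∈ Finset.range K,
        unitPhase ((a + i + j) ^ 2 * x) * unitPhase (-((a + i + j') ^ 2 * x)) := by
      intro i
      rw [Complex.ofReal_pow, ← Complex.mul_conj', hS, map_sum, Finset.sum_mul_sum]
      simp only [conj_unitPhase]
    rw [Complex.ofReal_sum, Finset.sum_congr rfl fun i _ => h3 i, Finset.sum_comm]
    exact Finset.sum_congr rfl fun j _ => Finset.sum_comm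
  have h3 : ∑ i ∈ Finset.range K, ‖S i‖ ^ 2 ≤
      3 * ∑ h ∈ Finset.range K, ‖∑ j ∈ Finset.range (K - h), F (j + h) j‖ := by
    have h4 : ∑ i ∈ Finset.range K, ‖S i‖ ^ 2 =
        ‖∑ j ∈ Finset.range K, ∑ j' ∈ Finset.range K, F j j'‖ := by
      rw [← h2, Complex.norm_real, Real.norm_of_nonneg (by positivity)]
    rw [h4]
    apply norm_sum_range_sum_range_le
    intro i j
    simp only [hF, map_sum, map_mul, conj_unitPhase, neg_neg]
    exact Finset.sum_congr rfl fun k _ => mul_comm _ _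
  have h4 : ∀ h, ‖∑ j ∈ Finset.range (K - h), F (j + h) j‖ =
      ‖geomPhase (K - h) ((2 * h : ℕ) * x)‖ * ‖geomPhase K ((2 * h : ℕ) * x)‖ := by
    intro h
    have h5 : ∑ j ∈ Finset.range (K - h), F (j + h) j = unitPhase (h * (2 * a + h) * x) *
        (geomPhase (K - h) ((2 * h : ℕ) * x) * geomPhase K ((2 * h : ℕ) * x)) := by
      rw [geomPhase, geomPhase, Finset.sum_mul_sum, Finset.mul_sum]
      refine Finset.sum_congr rfl fun j _ => ?_
      rw [Finset.mul_sum]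
      refine Finset.sum_congr rfl fun i _ => ?_
      rw [← unitPhase_add, ← unitPhase_add, ← unitPhase_add]
      congr 1
      push_cast
      ring
    rw [h5, norm_mul, norm_unitPhase, one_mul, norm_mul]
  simp only [h4] at h3
  refine h1.trans ?_
  rw [mul_comm (3 : ℝ), mul_assoc]
  gcongr

lemma norm_geomPhase_le_of_approx_dvd {K q M k : ℕ} {z : ℤ} {x : ℝ} (hq : 0 < q) (hM : M ≤ K)
    (hx : |x - z / q| ≤ 1 / ((4 * K + 1) * q)) (hk : q * k < 2 * K) :
    ‖geomPhase M ((q * k : ℕ) * x)‖ ≤ 2 * K / (1 + k * (K * q * |x - z / q|)) := by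
  set β := x - z / q with hβ
  have hq' : (0 : ℝ) < q := Nat.cast_pos.mpr hq
  have hMK : (M : ℝ) ≤ K := Nat.cast_le.mpr hM
  have hK0 : (0 : ℝ) ≤ K := Nat.cast_nonneg K
  have hk0 : (0 : ℝ) ≤ k := Nat.cast_nonneg k
  have hk' : (q : ℝ) * k < 2 * K := by exact_mod_cast hk
  have hK : (0 : ℝ) < K := by nlinarith
  rw [le_div_iff₀ (by positivity)]
  rcases le_or_gt (k * (K * q * |β|)) 1 with h1 | h1
  · have := norm_geomPhase_le M ((q * k : ℕ) * x)
    nlinarith [norm_nonneg (geomPhase M ((q * k : ℕ) * x))]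
  · have h2 : q * |β| ≤ 1 / (4 * K + 1) := by
      calc q * |β| ≤ q * (1 / ((4 * K + 1) * q)) := by gcongr
        _ = 1 / (4 * K + 1) := by field_simp
    have hq1 : (1 : ℝ) ≤ q := by exact_mod_cast hq
    have h3 : q * k * |β| ≤ 1 / 2 := by
      calc (q : ℝ) * k * |β| ≤ (q * k) * (q * |β|) := by
            nlinarith [mul_nonneg (mul_nonneg hq'.le hk0) (abs_nonneg β)]
        _ ≤ 2 * K * (1 / (4 * K + 1)) := by gcongr
        _ ≤ 1 / 2 := by rw [mul_one_div, div_le_div_iff₀ (by positivity) (by norm_num)]; linarith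
    have h4 : 0 < q * k * |β| := by
      by_contra h5
      have h6 : (q : ℝ) * k * |β| = 0 := le_antisymm (not_lt.mp h5) (by positivity)
      have h7 : k * (K * q * |β|) = K * (q * k * |β|) := by ring
      rw [h7, h6, mul_zero] at h1
      linarith
    have h5 : ∀ n : ℤ, q * k * |β| ≤ |((q * k : ℕ) : ℝ) * x - n| := by
      intro n
      have h6 : ((q * k : ℕ) : ℝ) * x - n = q * k * β + ((k * z - n : ℤ) : ℝ) := by
        rw [hβ]; push_cast; field_simp; ring
      have h7 : |(q : ℝ) * k * β| = q * k * |β| := by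
        rw [abs_mul, abs_of_nonneg (by positivity : (0 : ℝ) ≤ q * k)]
      rw [h6]
      rcases eq_or_ne (k * z - n) 0 with h8 | h8
      · rw [h8, Int.cast_zero, add_zero, h7]
      · have h9 : (1 : ℝ) ≤ |((k * z - n : ℤ) : ℝ)| := by
          rw [← Int.cast_abs]; exact_mod_cast Int.one_le_abs h8
        have h10 := abs_sub_abs_le_abs_add ((k * z - n : ℤ) : ℝ) (q * k * β)
        rw [add_comm] at h10
        linarith
    have h6 := norm_geomPhase_le_of_forall_int h4 h5 M
    rw [le_div_iff₀ (by positivity)] at h6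
    have h7 : k * (K * q * |β|) = K * (q * k * |β|) := by ring
    have h8 : 1 + k * (K * q * |β|) ≤ 2 * (K * (q * k * |β|)) := by linarith
    calc _ ≤ ‖geomPhase M ((q * k : ℕ) * x)‖ * (2 * (K * (q * k * |β|))) := by gcongr
      _ = K * (‖geomPhase M ((q * k : ℕ) * x)‖ * (2 * (q * k * |β|))) := by ring
      _ ≤ K * 1 := by gcongr
      _ ≤ 2 * K := by linarith

lemma norm_geomPhase_sq_le_of_approx_not_dvd {K q M h s : ℕ} {z w : ℤ} {x : ℝ} (hs : 0 < s)
    (hsq : s < q) (hx : |x - z / q| ≤ 1 / ((4 * K + 1) * q)) (hh : h < 2 * K)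
    (hw : (h : ℤ) * z = q * w + s) :
    ‖geomPhase M (h * x)‖ ^ 2 ≤ q ^ 2 * (1 / (s : ℝ) ^ 2 + 1 / ((q - s : ℕ) : ℝ) ^ 2) := by
  set β := x - z / q with hβ
  have hq' : (0 : ℝ) < q := by exact_mod_cast hs.trans hsq
  have hs1 : (1 : ℝ) ≤ s := by exact_mod_cast hs
  have hsq1 : (s : ℝ) + 1 ≤ q := by exact_mod_cast hsq
  have hh' : (h : ℝ) ≤ 2 * K := by exact_mod_cast hh.le
  have hw' : (h : ℝ) * z = q * w + s := by exact_mod_cast hw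
  rw [Nat.cast_sub hsq.le]
  have h1 : |h * β| ≤ 1 / (2 * q) := by
    rw [abs_mul, Nat.abs_cast]
    calc (h : ℝ) * |β| ≤ 2 * K * (1 / ((4 * K + 1) * q)) := by gcongr
      _ ≤ 1 / (2 * q) := by
        rw [mul_one_div, div_le_div_iff₀ (by positivity) (by positivity)]
        nlinarith
  set μ : ℝ := min (s : ℝ) (q - s) with hμ
  have hμ0 : 0 < μ := lt_min (by linarith) (by linarith)
  have h2 : ∀ n : ℤ, μ / (2 * q) ≤ |(h : ℝ) * x - n| := by
    intro n
    have h3 : (h : ℝ) * x - n = (s + q * ((w - n : ℤ) : ℝ)) / q + h * β := by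
      have h4 : (h : ℝ) * x = (h * z) / q + h * β := by rw [hβ]; field_simp; ring
      rw [h4, hw']
      push_cast
      field_simp
      ring
    have h1' : |h * β| ≤ (1 / 2) / q := by rw [div_div]; exact h1
    obtain ⟨h5, h6⟩ := abs_le.mp h1'
    have h7 : μ / (2 * q) = (μ / 2) / q := by rw [div_div]
    rw [h3, h7]
    rcases le_or_gt 0 (w - n) with h8 | h8
    · have h9 : (0 : ℝ) ≤ ((w - n : ℤ) : ℝ) := by exact_mod_cast h8
      refine le_trans ?_ (le_abs_self _)
      have h10 : (μ / 2) / q + (1 / 2) / q ≤ (s + q * ((w - n : ℤ) : ℝ)) / q := by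
        rw [← add_div]
        refine div_le_div_of_nonneg_right ?_ hq'.le
        have := min_le_left (s : ℝ) (q - s)
        nlinarith
      linarith
    · have h9 : ((w - n : ℤ) : ℝ) ≤ -1 := by exact_mod_cast Int.le_sub_one_of_lt h8
      refine le_trans ?_ (neg_le_abs _)
      have h10 : (s + q * ((w - n : ℤ) : ℝ)) / q + ((μ / 2) / q + (1 / 2) / q) ≤ 0 := by
        rw [← add_div, ← add_div]
        apply div_nonpos_of_nonpos_of_nonneg _ hq'.le
        have := min_le_right (s : ℝ) (q - s)
        nlinarith
      linarith
  have h3 := norm_geomPhase_le_of_forall_int (by positivity) h2 M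
  have h4 : 1 / (2 * (μ / (2 * q))) = q / μ := by field_simp
  rw [h4] at h3
  have h5 : 1 / μ ^ 2 ≤ 1 / (s : ℝ) ^ 2 + 1 / ((q : ℝ) - s) ^ 2 := by
    rcases min_choice (s : ℝ) (q - s) with h6 | h6 <;> rw [hμ, h6]
    · have : 0 ≤ 1 / ((q : ℝ) - s) ^ 2 := by positivity
      linarith
    · have : 0 ≤ 1 / (s : ℝ) ^ 2 := by positivity
      linarith
  calc ‖geomPhase M (h * x)‖ ^ 2 ≤ (q / μ) ^ 2 := by gcongr
    _ = q ^ 2 * (1 / μ ^ 2) := by rw [div_pow, mul_one_div]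
    _ ≤ _ := by gcongr

lemma sum_Ico_one_div_sq_le (n : ℕ) : ∑ s ∈ Finset.Ico 1 n, 1 / (s : ℝ) ^ 2 ≤ 2 := by
  have h : ∀ m : ℕ, ∑ s ∈ Finset.Ico 1 (m + 2), 1 / (s : ℝ) ^ 2 ≤ 2 - 1 / (m + 1 : ℝ) := by
    intro m
    induction m with
    | zero => norm_num
    | succ m ih =>
      rw [Finset.sum_Ico_succ_top (by omega)]
      have h1 : 1 / ((m + 2 : ℕ) : ℝ) ^ 2 ≤ 1 / (m + 1 : ℝ) - 1 / ((m + 1 : ℕ) + 1 : ℝ) := by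
        have h2 : 1 / (m + 1 : ℝ) - 1 / ((m + 1 : ℕ) + 1 : ℝ) = 1 / ((m + 1) * (m + 2)) := by
          push_cast
          field_simp
          ring
        rw [h2]
        push_cast
        gcongr
        nlinarith
      have h3 : m + 1 + 1 = m + 2 := rfl
      rw [h3]
      linarith
  rcases n with _ | _ | n
  · simp
  · simp
  · refine (h n).trans ?_
    have : (0 : ℝ) ≤ 1 / (n + 1 : ℝ) := by positivity
    linarith

lemma sum_range_one_div_sq_le {t : ℝ} (ht0 : 0 ≤ t) (ht1 : t ≤ 1) (L : ℕ) :
    ∑ k ∈ Finset.range L, 1 / (1 + k * t) ^ 2 ≤ 2 * L / (1 + L * t) := by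
  induction L with
  | zero => simp
  | succ L ih =>
    rw [Finset.sum_range_succ]
    have h1 : (0 : ℝ) ≤ L * t := by positivity
    have h2 : 2 * ((L + 1 : ℕ) : ℝ) / (1 + ((L + 1 : ℕ) : ℝ) * t) - 2 * L / (1 + L * t) =
        2 / ((1 + L * t) * (1 + L * t + t)) := by
      push_cast
      have h3 : 1 + (L + 1) * t ≠ 0 := by nlinarith
      have h4 : 1 + L * t ≠ 0 := by nlinarith
      have h5 : 1 + L * t + t ≠ 0 := by nlinarith
      field_simp
      ring
    have h3 : 1 / (1 + L * t) ^ 2 ≤ 2 / ((1 + L * t) * (1 + L * t + t)) := by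
      rw [div_le_div_iff₀ (by positivity) (by positivity)]
      nlinarith
    linarith

lemma sum_Ico_residues_le {q : ℕ} {z : ℤ} (hz : IsCoprime z (q : ℤ)) (f : ℕ → ℝ)
    (hf : ∀ s, 0 ≤ f s) :
    ∑ r ∈ Finset.Ico 1 q, f ((r * z % q : ℤ).toNat) ≤ ∑ s ∈ Finset.Ico 1 q, f s := by
  have hinj : Set.InjOn (fun r : ℕ => (r * z % q : ℤ).toNat) (Finset.Ico 1 q : Finset ℕ) := by
    intro r hr r' hr' h
    simp only [Finset.coe_Ico, Set.mem_Ico] at hr hr'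
    have hq : (q : ℤ) ≠ 0 := by omega
    have h1 : (r * z % q : ℤ) = (r' * z % q : ℤ) := by
      have h2 := Int.toNat_of_nonneg (Int.emod_nonneg (r * z) hq)
      have h3 := Int.toNat_of_nonneg (Int.emod_nonneg (r' * z) hq)
      simp only at h
      rw [← h2, ← h3, h]
    have h2 : (q : ℤ) ∣ (r' - r : ℤ) * z := by
      rw [sub_mul]; exact Int.ModEq.dvd h1
    have h3 : (q : ℤ) ∣ (r' - r : ℤ) := hz.symm.dvd_of_dvd_mul_right h2
    have h4 := Int.eq_zero_of_abs_lt_dvd h3 (by rw [abs_lt]; omega)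
    omega
  rw [← Finset.sum_image (f := f) hinj]
  refine Finset.sum_le_sum_of_subset_of_nonneg ?_ fun s _ _ => hf s
  intro s hs
  obtain ⟨r, hr, rfl⟩ := Finset.mem_image.mp hs
  rw [Finset.mem_Ico] at hr ⊢
  have hq : (0 : ℤ) < q := by omega
  have h1 := Int.emod_nonneg (r * z) hq.ne'
  have h2 := Int.emod_lt_of_pos (r * z) hq
  have h3 : (r * z % q : ℤ) ≠ 0 := by
    intro h4
    have h5 : (q : ℤ) ∣ r := hz.symm.dvd_of_dvd_mul_right (Int.dvd_of_emod_eq_zero h4)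
    have := Int.le_of_dvd (by omega) h5
    omega
  omega

lemma sum_range_mul (f : ℕ → ℝ) (q L : ℕ) :
    ∑ h ∈ Finset.range (q * L), f h =
      ∑ k ∈ Finset.range L, ∑ r ∈ Finset.range q, f (q * k + r) := by
  induction L with
  | zero => simp
  | succ L ih => rw [Nat.mul_succ, Finset.sum_range_add, ih, Finset.sum_range_succ]

/-- Log-free major arc bound for tent-weighted quadratic sums. -/
lemma norm_tentSum_sq_le_of_approx {K q : ℕ} {z : ℤ} {x : ℝ} (hK : 0 < K) (hq : 0 < q)
    (hqK : q ≤ 4 * K) (hz : IsCoprime z (q : ℤ))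
    (hx : |x - z / q| ≤ 1 / ((4 * K + 1) * q)) (a : ℝ) :
    ‖tentSum K a x‖ ^ 2 ≤ 1500 * (K ^ 2 / (q * (1 + K ^ 2 * |x - z / q|))) := by
  set β := x - z / q with hβ
  have hq' : (0 : ℝ) < q := Nat.cast_pos.mpr hq
  have hq1 : (1 : ℝ) ≤ q := by exact_mod_cast hq
  have hK' : (0 : ℝ) < K := Nat.cast_pos.mpr hK
  have hqK' : (q : ℝ) ≤ 4 * K := by exact_mod_cast hqK
  set t := K * q * |β| with ht
  have ht0 : 0 ≤ t := by positivity
  have ht1 : t ≤ 1 := by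
    calc K * q * |β| ≤ K * q * (1 / ((4 * K + 1) * q)) := by gcongr
      _ = K / (4 * K + 1) := by field_simp
      _ ≤ 1 := by rw [div_le_one (by positivity)]; linarith
  set σ : ℕ → ℕ := fun r => (r * z % q : ℤ).toNat with hσ
  set f : ℕ → ℝ := fun s => q ^ 2 * (1 / (s : ℝ) ^ 2 + 1 / ((q - s : ℕ) : ℝ) ^ 2) with hf
  have hf0 : ∀ s, 0 ≤ f s := fun s => by positivity
  set b : ℕ → ℝ := fun h => if h % q = 0 then (2 * K / (1 + (h / q : ℕ) * t)) ^ 2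
    else f (σ (h % q)) with hb
  have hb0 : ∀ h, 0 ≤ b h := by
    intro h
    simp only [hb]
    split_ifs
    · positivity
    · exact hf0 _
  have hD : ∀ h < 2 * K, ∀ M ≤ K, ‖geomPhase M (h * x)‖ ^ 2 ≤ b h := by
    intro h hh M hM
    simp only [hb]
    have hdiv := Nat.div_add_mod h q
    split_ifs with h0
    · have h1 : h = q * (h / q) := by omega
      have h2 := norm_geomPhase_le_of_approx_dvd hq hM hx (k := h / q) (by omega)
      rw [← h1] at h2
      gcongr
    · have hq0 : (0 : ℤ) < q := by exact_mod_cast hq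
      have hr : h % q < q := Nat.mod_lt _ hq
      have h1 := Int.emod_nonneg ((h % q : ℕ) * z) hq0.ne'
      have h2 := Int.emod_lt_of_pos ((h % q : ℕ) * z) hq0
      have h3 : ((h % q : ℕ) * z % q : ℤ) ≠ 0 := by
        intro h4
        have h5 : (q : ℤ) ∣ (h % q : ℕ) :=
          hz.symm.dvd_of_dvd_mul_right (Int.dvd_of_emod_eq_zero h4)
        have := Int.le_of_dvd (by omega) h5
        omega
      have h4 : ((σ (h % q) : ℕ) : ℤ) = (h % q : ℕ) * z % q := Int.toNat_of_nonneg h1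
      have h5 := Int.mul_ediv_add_emod ((h % q : ℕ) * z) q
      refine norm_geomPhase_sq_le_of_approx_not_dvd (w := (h / q : ℕ) * z + (h % q : ℕ) * z / q)
        (z := z) (by omega) (by omega) hx hh ?_
      rw [h4, mul_add, add_assoc, h5]
      conv_lhs => rw [← hdiv]
      push_cast
      ring
  have hsum1 : ∑ h ∈ Finset.range K,
      ‖geomPhase (K - h) ((2 * h : ℕ) * x)‖ * ‖geomPhase K ((2 * h : ℕ) * x)‖ ≤
      ∑ h ∈ Finset.range K, b (2 * h) := by
    refine Finset.sum_le_sum fun h hh => ?_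
    have hh' := Finset.mem_range.mp hh
    have h1 := hD (2 * h) (by omega) (K - h) (Nat.sub_le _ _)
    have h2 := hD (2 * h) (by omega) K le_rfl
    nlinarith [sq_nonneg (‖geomPhase (K - h) ((2 * h : ℕ) * x)‖ - ‖geomPhase K ((2 * h : ℕ) * x)‖)]
  set L := 2 * K / q + 1 with hL
  have hLq : 2 * K ≤ q * L := by
    have := Nat.lt_mul_div_succ (2 * K) hq
    rw [hL]; omega
  have hsum2 : ∑ h ∈ Finset.range K, b (2 * h) ≤ ∑ h ∈ Finset.range (q * L), b h := by
    rw [← Finset.sum_image (f := b) (g := fun h => 2 * h) (fun x _ y _ h => by simpa using h)]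
    refine Finset.sum_le_sum_of_subset_of_nonneg ?_ fun s _ _ => hb0 s
    intro s hs
    obtain ⟨r, hr, rfl⟩ := Finset.mem_image.mp hs
    rw [Finset.mem_range] at hr ⊢
    omega
  have hres : ∑ r ∈ Finset.Ico 1 q, f (σ r) ≤ 4 * q ^ 2 := by
    refine (sum_Ico_residues_le hz f hf0).trans ?_
    rw [hf, ← Finset.mul_sum, Finset.sum_add_distrib]
    have h1 := Finset.sum_Ico_reflect (fun s : ℕ => 1 / (s : ℝ) ^ 2) 1 (m := q) (n := q) (by omega)
    have h2 : q + 1 - q = 1 := by omega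
    rw [h2, Nat.add_sub_cancel] at h1
    rw [h1]
    nlinarith [sum_Ico_one_div_sq_le q, sq_nonneg (q : ℝ)]
  have hblock : ∀ k, ∑ r ∈ Finset.range q, b (q * k + r) ≤
      4 * K ^ 2 * (1 / (1 + k * t) ^ 2) + 4 * q ^ 2 := by
    intro k
    rw [Finset.range_eq_Ico, Finset.sum_eq_sum_Ico_succ_bot hq]
    have h1 : b (q * k + 0) = 4 * K ^ 2 * (1 / (1 + k * t) ^ 2) := by
      simp only [hb, add_zero, Nat.mul_mod_right, if_true, Nat.mul_div_cancel_left _ hq]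
      rw [div_pow]
      ring
    have h2 : ∑ r ∈ Finset.Ico (0 + 1) q, b (q * k + r) = ∑ r ∈ Finset.Ico 1 q, f (σ r) := by
      refine Finset.sum_congr rfl fun r hr => ?_
      obtain ⟨h3, h4⟩ := Finset.mem_Ico.mp hr
      have h5 : (q * k + r) % q = r := by rw [Nat.mul_add_mod, Nat.mod_eq_of_lt h4]
      simp only [hb, h5]
      rw [if_neg (by omega)]
    rw [h1, h2]
    linarith
  have hL1 : (L : ℝ) ≤ 6 * K / q := by
    rw [le_div_iff₀ hq']
    have : L * q ≤ 2 * K + q := by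
      rw [hL, add_mul, one_mul]
      have := Nat.div_mul_le_self (2 * K) q
      omega
    have h1 : (L : ℝ) * q ≤ 2 * K + q := by exact_mod_cast this
    linarith
  have hL2 : K ^ 2 * |β| ≤ L * t := by
    have h1 : 2 * (K : ℝ) ≤ q * L := by exact_mod_cast hLq
    have h2 : L * t = (q * L) * (K * |β|) := by rw [ht]; ring
    rw [h2]
    nlinarith [mul_nonneg hK'.le (abs_nonneg β)]
  have hsum3 : ∑ h ∈ Finset.range (q * L), b h ≤
      4 * K ^ 2 * (12 * K / q / (1 + K ^ 2 * |β|)) + 24 * K * q := by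
    rw [sum_range_mul]
    refine (Finset.sum_le_sum fun k _ => hblock k).trans ?_
    rw [Finset.sum_add_distrib, ← Finset.mul_sum, Finset.sum_const, Finset.card_range, nsmul_eq_mul]
    have h1 := sum_range_one_div_sq_le ht0 ht1 L
    have h2 : 2 * L / (1 + L * t) ≤ 12 * K / q / (1 + K ^ 2 * |β|) := by
      have h3 : 2 * (L : ℝ) ≤ 12 * K / q := by
        calc 2 * (L : ℝ) ≤ 2 * (6 * K / q) := by gcongr
          _ = 12 * K / q := by ring
      gcongr
    have h3 : (L : ℝ) * (4 * q ^ 2) ≤ 24 * (K : ℝ) * q := by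
      calc (L : ℝ) * (4 * q ^ 2) ≤ 6 * K / q * (4 * q ^ 2) := by gcongr
        _ = 24 * (K : ℝ) * q := by field_simp; ring
    have h4 := h1.trans h2
    gcongr
  have hfin : (K : ℝ) * q ≤ 17 * (K ^ 3 / (q * (1 + K ^ 2 * |β|))) := by
    rw [← mul_div_assoc, le_div_iff₀ (by positivity)]
    have h1 : K * q * (q * (1 + K ^ 2 * |β|)) = K * (q ^ 2 + K * q * t) := by rw [ht]; ring
    rw [h1]
    have h2 : (q : ℝ) ^ 2 ≤ 16 * K ^ 2 := by nlinarith
    have h3 : q * t ≤ K := by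
      calc q * t = K * q * (q * |β|) := by rw [ht]; ring
        _ ≤ K * q * (q * (1 / ((4 * K + 1) * q))) := by gcongr
        _ = K * (q / (4 * K + 1)) := by field_simp
        _ ≤ K * 1 := by
          gcongr
          rw [div_le_one (by positivity)]
          linarith
        _ = K := mul_one _
    calc (K : ℝ) * (q ^ 2 + K * q * t) = (K : ℝ) * (q ^ 2 + K * (q * t)) := by ring
      _ ≤ (K : ℝ) * (16 * K ^ 2 + K * K) := by gcongr
      _ = 17 * (K : ℝ) ^ 3 := by ring
  refine (norm_tentSum_sq_le hK a x).trans ?_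
  have h1 := hsum1.trans (hsum2.trans hsum3)
  have h2 : 4 * (K : ℝ) ^ 2 * (12 * K / q / (1 + K ^ 2 * |β|)) =
      48 * (K ^ 3 / (q * (1 + K ^ 2 * |β|))) := by
    rw [div_div]; ring
  rw [h2] at h1
  calc _ ≤ 3 * (K : ℝ)⁻¹ * (500 * (K ^ 3 / (q * (1 + K ^ 2 * |β|)))) := by
        have h3 : 0 ≤ (K : ℝ) ^ 3 / (q * (1 + K ^ 2 * |β|)) := by positivity
        gcongr
        linarith
    _ = _ := by field_simp; ring

lemma continuous_tentSum (K : ℕ) (a : ℝ) : Continuous (tentSum K a) := by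
  unfold tentSum
  refine continuous_const.mul (continuous_finsetSum _ fun i _ => continuous_finsetSum _ fun j _ => ?_)
  exact continuous_unitPhase.comp (continuous_const.mul continuous_id)

lemma norm_tentSum_rpow_le {p : ℝ} (hp : 0 < p) {K : ℕ} (hK : 0 < K) (a : ℝ) {x : ℝ}
    (hx : x ∈ Set.Icc (0 : ℝ) 1) :
    ‖tentSum K a x‖ ^ p ≤ ∑ q ∈ Finset.Icc 1 (4 * K), ∑ z ∈ Finset.range (q + 1),
      (1500 * (K ^ 2 / q : ℝ)) ^ (p / 2) * (1 + ‖(K : ℝ) ^ 2 * (x - z / q)‖) ^ (-(p / 2)) := by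
  obtain ⟨r, hr, hden⟩ := Real.exists_rat_abs_sub_le_and_den_le x (n := 4 * K) (by omega)
  set q := r.den with hq
  have hq0 : 0 < q := r.den_pos
  have hq' : (0 : ℝ) < q := Nat.cast_pos.mpr hq0
  have hK' : (0 : ℝ) < K := Nat.cast_pos.mpr hK
  have hrq : (r : ℝ) = r.num / q := Rat.cast_def r
  push_cast at hr
  rw [hrq] at hr
  obtain ⟨h1, h2⟩ := abs_le.mp hr
  have h3 : 1 / ((4 * K + 1) * q : ℝ) * q < 1 := by
    rw [one_div_mul_eq_div, div_lt_one (by positivity)]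
    nlinarith
  have h4 : (r.num : ℝ) / q * q = r.num := by field_simp
  have hz0 : 0 ≤ r.num := by
    have h5 : (-1 : ℝ) < r.num := by nlinarith [hx.1]
    have h6 : (-1 : ℤ) < r.num := by exact_mod_cast h5
    omega
  have hz1 : r.num ≤ q := by
    have h5 : (r.num : ℝ) < q + 1 := by nlinarith [hx.2]
    have h6 : r.num < q + 1 := by exact_mod_cast h5
    omega
  obtain ⟨z, hz⟩ := Int.eq_ofNat_of_zero_le hz0
  have hcop : IsCoprime r.num (q : ℤ) := Int.isCoprime_iff_gcd_eq_one.mpr r.reduced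
  have hmain := norm_tentSum_sq_le_of_approx hK hq0 hden hcop hr a
  have hzr : (r.num : ℝ) = z := by rw [hz]; simp
  rw [hzr] at hmain
  have hb : ‖tentSum K a x‖ ^ p ≤ (1500 * (K ^ 2 / q : ℝ)) ^ (p / 2) *
      (1 + ‖(K : ℝ) ^ 2 * (x - z / q)‖) ^ (-(p / 2)) := by
    have h5 : ‖tentSum K a x‖ ^ p = (‖tentSum K a x‖ ^ 2) ^ (p / 2) := by
      rw [← Real.rpow_natCast, ← Real.rpow_mul (norm_nonneg _)]
      congr 1
      push_cast
      ring
    have h6 : ‖(K : ℝ) ^ 2 * (x - z / q)‖ = K ^ 2 * |x - z / q| := by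
      rw [norm_mul, Real.norm_eq_abs, Real.norm_eq_abs, abs_of_nonneg (by positivity)]
    rw [h5, h6, Real.rpow_neg (by positivity), ← div_eq_mul_inv,
      ← Real.div_rpow (by positivity) (by positivity)]
    refine Real.rpow_le_rpow (by positivity) (hmain.trans (le_of_eq ?_)) (by positivity)
    rw [mul_div_assoc, div_div]
  refine hb.trans ?_
  set G : ℕ → ℕ → ℝ := fun q z => (1500 * (K ^ 2 / q : ℝ)) ^ (p / 2) *
      (1 + ‖(K : ℝ) ^ 2 * (x - z / q)‖) ^ (-(p / 2)) with hG
  have hG0 : ∀ q z, 0 ≤ G q z := fun q z => by positivity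
  calc G q z ≤ ∑ z ∈ Finset.range (q + 1), G q z :=
        Finset.single_le_sum (f := fun z => G q z) (fun z _ => hG0 q z)
          (Finset.mem_range.mpr (by omega))
    _ ≤ ∑ q ∈ Finset.Icc 1 (4 * K), ∑ z ∈ Finset.range (q + 1), G q z :=
        Finset.single_le_sum (f := fun q => ∑ z ∈ Finset.range (q + 1), G q z)
          (fun q _ => Finset.sum_nonneg fun z _ => hG0 q z) (Finset.mem_Icc.mpr ⟨hq0, hden⟩)

lemma integral_one_add_norm_mul_sub_le {s : ℝ} (hs : 1 < s) {A : ℝ} (hA : 0 < A) (b : ℝ) :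
    ∫ x in (0 : ℝ)..1, (1 + ‖A * (x - b)‖) ^ (-s) ≤ A⁻¹ * ∫ y : ℝ, (1 + ‖y‖) ^ (-s) := by
  have hint : Integrable (fun y : ℝ => (1 + ‖y‖) ^ (-s)) := by
    apply integrable_one_add_norm
    simpa using hs
  have h1 : Integrable (fun x : ℝ => (1 + ‖A * (x - b)‖) ^ (-s)) :=
    (hint.comp_mul_left' hA.ne').comp_sub_right b
  rw [intervalIntegral.integral_of_le zero_le_one]
  refine (setIntegral_le_integral h1 (Filter.Eventually.of_forall fun x => by positivity)).trans ?_
  rw [integral_sub_right_eq_self (fun x : ℝ => (1 + ‖A * x‖) ^ (-s)) b,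
    Measure.integral_comp_mul_left (fun y : ℝ => (1 + ‖y‖) ^ (-s)) A, abs_of_pos (inv_pos.mpr hA),
    smul_eq_mul]

lemma exists_integral_tentSum_rpow_le {p : ℝ} (hp : 2 < p) :
    ∃ C : ℝ, 0 < C ∧ ∀ K : ℕ, 0 < K → ∀ a : ℝ,
      ∫ x in (0 : ℝ)..1, ‖tentSum K a x‖ ^ p ≤
        C * ((K : ℝ) ^ (p - 2) * ∑ q ∈ Finset.Icc 1 (4 * K), (q : ℝ) ^ (1 - p / 2)) := by
  set I : ℝ := ∫ y : ℝ, (1 + ‖y‖) ^ (-(p / 2)) with hI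
  have hI0 : 0 ≤ I := integral_nonneg fun y => by positivity
  refine ⟨1500 ^ (p / 2) * (2 * (I + 1)), by positivity, fun K hK a => ?_⟩
  have hK' : (0 : ℝ) < K := Nat.cast_pos.mpr hK
  have hcont : ∀ c b : ℝ,
      Continuous fun x : ℝ => c * (1 + ‖(K : ℝ) ^ 2 * (x - b)‖) ^ (-(p / 2)) := by
    intro c b
    refine continuous_const.mul (Continuous.rpow_const (by fun_prop) fun x => Or.inl ?_)
    positivity
  have h1 : ∫ x in (0 : ℝ)..1, ‖tentSum K a x‖ ^ p ≤
      ∫ x in (0 : ℝ)..1, ∑ q ∈ Finset.Icc 1 (4 * K), ∑ z ∈ Finset.range (q + 1),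
      (1500 * (K ^ 2 / q : ℝ)) ^ (p / 2) * (1 + ‖(K : ℝ) ^ 2 * (x - z / q)‖) ^ (-(p / 2)) := by
    refine intervalIntegral.integral_mono_on zero_le_one ?_ ?_ fun x hx =>
      norm_tentSum_rpow_le (by linarith) hK a hx
    · exact ((continuous_tentSum K a).norm.rpow_const
        fun x => Or.inr (by linarith)).intervalIntegrable _ _
    · exact Continuous.intervalIntegrable (continuous_finsetSum _ fun q _ =>
        continuous_finsetSum _ fun z _ => hcont _ _) _ _
  refine h1.trans ?_
  rw [intervalIntegral.integral_finsetSum]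
  swap
  · exact fun q _ => (continuous_finsetSum _ fun z _ => hcont _ _).intervalIntegrable _ _
  rw [← mul_assoc, Finset.mul_sum]
  refine Finset.sum_le_sum fun q hq => ?_
  have hq1 : 1 ≤ q := (Finset.mem_Icc.mp hq).1
  have hq' : (1 : ℝ) ≤ q := by exact_mod_cast hq1
  have hq0 : (0 : ℝ) < q := by linarith
  rw [intervalIntegral.integral_finsetSum]
  swap
  · exact fun z _ => (hcont _ _).intervalIntegrable _ _
  have h2 : ∀ z ∈ Finset.range (q + 1), ∫ x in (0 : ℝ)..1, (1500 * (K ^ 2 / q : ℝ)) ^ (p / 2) *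
      (1 + ‖(K : ℝ) ^ 2 * (x - z / q)‖) ^ (-(p / 2)) ≤
      (1500 * (K ^ 2 / q : ℝ)) ^ (p / 2) * (((K : ℝ) ^ 2)⁻¹ * I) := by
    intro z _
    rw [intervalIntegral.integral_const_mul]
    gcongr
    exact integral_one_add_norm_mul_sub_le (by linarith) (by positivity) _
  refine (Finset.sum_le_sum h2).trans ?_
  rw [Finset.sum_const, Finset.card_range, nsmul_eq_mul,
    Real.mul_rpow (by norm_num) (by positivity), Real.div_rpow (by positivity) (by positivity)]
  have h3 : ((K : ℝ) ^ 2) ^ (p / 2) = (K : ℝ) ^ (p - 2) * K ^ 2 := by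
    rw [← Real.rpow_natCast, ← Real.rpow_mul hK'.le, ← Real.rpow_add hK']
    congr 1
    push_cast
    ring
  have h4 : (q : ℝ) ^ (1 - p / 2) = q / (q : ℝ) ^ (p / 2) := by
    rw [Real.rpow_sub hq0, Real.rpow_one]
  rw [h3, h4]
  have h5 : ((q + 1 : ℕ) : ℝ) ≤ 2 * q := by push_cast; linarith
  calc _ ≤ (2 * q : ℝ) * (1500 ^ (p / 2) * ((K : ℝ) ^ (p - 2) * K ^ 2 / (q : ℝ) ^ (p / 2)) *
        (((K : ℝ) ^ 2)⁻¹ * (I + 1))) := by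
        gcongr
        linarith
    _ = _ := by field_simp

lemma sum_Icc_rpow_neg_le {α : ℝ} (h0 : 0 ≤ α) (h1 : α < 1) (n : ℕ) :
    ∑ q ∈ Finset.Icc 1 n, (q : ℝ) ^ (-α) ≤ (1 - α)⁻¹ * (n : ℝ) ^ (1 - α) := by
  induction n with
  | zero => simp [Real.zero_rpow (by linarith : 1 - α ≠ 0)]
  | succ n ih =>
    rw [Finset.sum_Icc_succ_top (by omega)]
    have hm : (0 : ℝ) < ((n + 1 : ℕ) : ℝ) := by positivity
    set m : ℝ := ((n + 1 : ℕ) : ℝ) with hmdef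
    have hn : (n : ℝ) = m * (1 + -m⁻¹) := by
      rw [mul_add, mul_neg, mul_inv_cancel₀ hm.ne', hmdef]; push_cast; ring
    have hm1 : m⁻¹ ≤ 1 := inv_le_one_of_one_le₀ (by rw [hmdef]; push_cast; linarith [(Nat.cast_nonneg n : (0 : ℝ) ≤ n)])
    have h2 : (n : ℝ) ^ (1 - α) ≤ m ^ (1 - α) - (1 - α) * m ^ (-α) := by
      have h3 := rpow_one_add_le_one_add_mul_self (s := -m⁻¹) (by linarith) (p := 1 - α)
        (by linarith) (by linarith)
      have h4 : m ^ (1 - α) * m⁻¹ = m ^ (-α) := by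
        rw [← Real.rpow_neg_one m, ← Real.rpow_add hm]
        congr 1
        ring
      rw [hn, Real.mul_rpow hm.le (by linarith), ← h4]
      calc _ ≤ m ^ (1 - α) * (1 + (1 - α) * -m⁻¹) := by gcongr
        _ = _ := by ring
    have h3 : 0 < 1 - α := by linarith
    have h4 : (1 - α)⁻¹ * (n : ℝ) ^ (1 - α) ≤
        (1 - α)⁻¹ * (m ^ (1 - α) - (1 - α) * m ^ (-α)) := by gcongr
    have h5 : (1 - α)⁻¹ * (m ^ (1 - α) - (1 - α) * m ^ (-α)) =
        (1 - α)⁻¹ * m ^ (1 - α) - m ^ (-α) := by field_simp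
    linarith

/-- The `L^p` norm over one period. -/
noncomputable def circleNorm (p : ℝ) (F : ℝ → ℂ) : ℝ :=
  (∫ x in (0 : ℝ)..1, ‖F x‖ ^ p) ^ p⁻¹

lemma circleNorm_eq_lpNorm {p : ℝ} (hp : 0 < p) {F : ℝ → ℂ} (hF : Continuous F) :
    circleNorm p F = lpNorm F (ENNReal.ofReal p) (volume.restrict (Set.Ioc (0 : ℝ) 1)) := by
  rw [lpNorm_eq_integral_norm_rpow_toReal (by simpa using hp) ENNReal.ofReal_ne_top
    hF.aestronglyMeasurable, circleNorm, intervalIntegral.integral_of_le zero_le_one,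
    ENNReal.toReal_ofReal hp.le]

lemma memLp_restrict_Ioc {p : ℝ} {F : ℝ → ℂ} (hF : Continuous F) :
    MemLp F (ENNReal.ofReal p) (volume.restrict (Set.Ioc (0 : ℝ) 1)) := by
  obtain ⟨C, hC⟩ := isCompact_Icc.exists_bound_of_continuousOn (s := Set.Icc (0 : ℝ) 1)
    hF.continuousOn
  refine MemLp.of_bound hF.aestronglyMeasurable C ?_
  refine (ae_restrict_iff' measurableSet_Ioc).mpr (Filter.Eventually.of_forall fun x hx => ?_)
  exact hC x (Set.Ioc_subset_Icc_self hx)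

lemma circleNorm_add_le {p : ℝ} (hp : 1 ≤ p) {F G : ℝ → ℂ} (hF : Continuous F)
    (hG : Continuous G) :
    circleNorm p (fun x => F x + G x) ≤ circleNorm p F + circleNorm p G := by
  have hp0 : 0 < p := by linarith
  have hFG : Continuous fun x => F x + G x := hF.add hG
  rw [circleNorm_eq_lpNorm hp0 hF, circleNorm_eq_lpNorm hp0 hG, circleNorm_eq_lpNorm hp0 hFG]
  exact lpNorm_add_le (memLp_restrict_Ioc hF) (by simpa using hp)

lemma circleNorm_const_mul {p : ℝ} (hp : 0 < p) (c : ℂ) (F : ℝ → ℂ) :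
    circleNorm p (fun x => c * F x) = ‖c‖ * circleNorm p F := by
  have h : ∀ x, ‖c * F x‖ ^ p = ‖c‖ ^ p * ‖F x‖ ^ p := fun x => by
    rw [norm_mul, Real.mul_rpow (norm_nonneg _) (norm_nonneg _)]
  simp only [circleNorm, h]
  rw [intervalIntegral.integral_const_mul, Real.mul_rpow (by positivity)
    (intervalIntegral.integral_nonneg zero_le_one fun x _ => by positivity),
    Real.rpow_rpow_inv (norm_nonneg _) hp.ne']

/-- `∑_{i<n} e^{2πi(a+i)²x}`. -/
noncomputable def intervalSum (n : ℕ) (a x : ℝ) : ℂ :=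
  ∑ i ∈ Finset.range n, unitPhase ((a + i) ^ 2 * x)

/-- `∑_{i<n} (i/n) e^{2πi(a+i)²x}`. -/
noncomputable def rampSum (n : ℕ) (a x : ℝ) : ℂ :=
  ∑ i ∈ Finset.range n, ((i : ℂ) / n) * unitPhase ((a + i) ^ 2 * x)

lemma continuous_unitPhase_mul (c : ℝ) : Continuous fun x : ℝ => unitPhase (c * x) :=
  continuous_unitPhase.comp (continuous_const.mul continuous_id)

lemma continuous_intervalSum (n : ℕ) (a : ℝ) : Continuous (intervalSum n a) :=
  continuous_finsetSum _ fun _ _ => continuous_unitPhase_mul _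

lemma continuous_rampSum (n : ℕ) (a : ℝ) : Continuous (rampSum n a) :=
  continuous_finsetSum _ fun _ _ => continuous_const.mul (continuous_unitPhase_mul _)

lemma sum_range_sum_range_add_one (g : ℕ → ℂ) (K : ℕ) :
    ∑ i ∈ Finset.range K, ∑ j ∈ Finset.range K, g (1 + i + j) =
      ∑ i ∈ Finset.range K, (i : ℂ) * g i + ∑ i ∈ Finset.range K, ((K : ℂ) - i) * g (K + i) := by
  induction K with
  | zero => simp
  | succ K ih =>
    have h1 : ∑ i ∈ Finset.range (K + 1), ∑ j ∈ Finset.range (K + 1), g (1 + i + j) =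
        ∑ i ∈ Finset.range K, ∑ j ∈ Finset.range K, g (1 + i + j) +
        2 * ∑ i ∈ Finset.range K, g (K + (i + 1)) + g (K + (K + 1)) := by
      simp only [Finset.sum_range_succ _ K, Finset.sum_add_distrib]
      have h2 : ∑ i ∈ Finset.range K, g (1 + i + K) = ∑ i ∈ Finset.range K, g (K + (i + 1)) :=
        Finset.sum_congr rfl fun i _ => by congr 1; ring
      have h3 : ∑ j ∈ Finset.range K, g (1 + K + j) = ∑ i ∈ Finset.range K, g (K + (i + 1)) :=
        Finset.sum_congr rfl fun i _ => by congr 1; ring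
      have h4 : 1 + K + K = K + (K + 1) := by ring
      rw [h2, h3, h4]
      ring
    have h2 : ∑ i ∈ Finset.range (K + 1), (((K + 1 : ℕ) : ℂ) - i) * g (K + 1 + i) =
        ∑ i ∈ Finset.range K, ((K : ℂ) - (i + 1 : ℕ)) * g (K + (i + 1)) +
        2 * ∑ i ∈ Finset.range K, g (K + (i + 1)) + g (K + (K + 1)) := by
      rw [Finset.sum_range_succ, Finset.mul_sum, ← Finset.sum_add_distrib]
      congr 1
      · refine Finset.sum_congr rfl fun i _ => ?_
        rw [show K + 1 + i = K + (i + 1) by ring]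
        push_cast
        ring
      · rw [show K + 1 + K = K + (K + 1) by ring]
        push_cast
        ring
    have h3 : ∑ i ∈ Finset.range K, ((K : ℂ) - (i + 1 : ℕ)) * g (K + (i + 1)) + (K : ℂ) * g K =
        ∑ i ∈ Finset.range K, ((K : ℂ) - i) * g (K + i) := by
      have h4 := Finset.sum_range_succ' (fun i : ℕ => ((K : ℂ) - i) * g (K + i)) K
      rw [Finset.sum_range_succ] at h4
      simp only [sub_self, zero_mul, add_zero, Nat.cast_zero, sub_zero] at h4
      exact h4.symm
    rw [h1, h2, Finset.sum_range_succ (fun i : ℕ => (i : ℂ) * g i), ih, ← h3]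
    ring

lemma rampSum_two_mul {K : ℕ} (hK : 0 < K) (a x : ℝ) :
    rampSum (2 * K) a x = 1 / 2 * tentSum K (a + 1) x + rampSum K (a + K) x := by
  have hK' : (K : ℂ) ≠ 0 := Nat.cast_ne_zero.mpr hK.ne'
  have h1 := sum_range_sum_range_add_one (fun m => unitPhase ((a + m) ^ 2 * x)) K
  have h2 : tentSum K (a + 1) x = (K : ℂ)⁻¹ * (∑ i ∈ Finset.range K, ∑ j ∈ Finset.range K,
      unitPhase ((a + (1 + i + j : ℕ)) ^ 2 * x)) := by
    rw [tentSum]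
    congr 1
    refine Finset.sum_congr rfl fun i _ => Finset.sum_congr rfl fun j _ => ?_
    congr 1
    push_cast
    ring
  rw [h2, h1, rampSum, rampSum, two_mul, Finset.sum_range_add, ← mul_assoc, mul_add, Finset.mul_sum,
    Finset.mul_sum, add_assoc]
  refine congrArg₂ (· + ·) ?_ ?_
  · refine Finset.sum_congr rfl fun i _ => ?_
    push_cast
    field_simp
    ring
  · rw [← Finset.sum_add_distrib]
    refine Finset.sum_congr rfl fun i _ => ?_
    push_cast
    rw [← add_assoc]
    field_simp
    ring

lemma intervalSum_eq_rampSum_add {n : ℕ} (hn : 0 < n) (a x : ℝ) :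
    intervalSum n a x = rampSum n a x + (rampSum n (-a - n) x + unitPhase (a ^ 2 * x)) := by
  obtain ⟨m, rfl⟩ : ∃ m, n = m + 1 := ⟨n - 1, by omega⟩
  have hm : ((m + 1 : ℕ) : ℂ) ≠ 0 := Nat.cast_ne_zero.mpr hn.ne'
  have h1 : rampSum (m + 1) (-a - (m + 1 : ℕ)) x + unitPhase (a ^ 2 * x) =
      ∑ i ∈ Finset.range (m + 1), (1 - (i : ℂ) / (m + 1 : ℕ)) * unitPhase ((a + i) ^ 2 * x) := by
    rw [rampSum, Finset.sum_range_succ', Finset.sum_range_succ']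
    simp only [Nat.cast_zero, zero_div, zero_mul, add_zero, sub_zero, one_mul]
    congr 1
    rw [← Finset.sum_range_reflect]
    refine Finset.sum_congr rfl fun i hi => ?_
    have hi' : i + 1 ≤ m := Finset.mem_range.mp hi
    have h2 : m - 1 - i + 1 = m - i := by omega
    rw [h2]
    congr 1
    · rw [Nat.cast_sub (by omega)]
      field_simp
      push_cast
      ring
    · congr 1
      rw [Nat.cast_sub (by omega)]
      push_cast
      ring
  rw [h1, intervalSum, rampSum, ← Finset.sum_add_distrib]
  refine Finset.sum_congr rfl fun i _ => ?_
  ring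

lemma intervalSum_add (m n : ℕ) (a x : ℝ) :
    intervalSum (m + n) a x = intervalSum m a x + intervalSum n (a + m) x := by
  rw [intervalSum, intervalSum, intervalSum, Finset.sum_range_add]
  congr 1
  refine Finset.sum_congr rfl fun i _ => ?_
  congr 1
  push_cast
  ring

lemma circleNorm_unitPhase (p c : ℝ) : circleNorm p (fun x => unitPhase (c * x)) = 1 := by
  simp [circleNorm, norm_unitPhase]

lemma circleNorm_zero {p : ℝ} (hp : 0 < p) : circleNorm p (fun _ => 0) = 0 := by
  simp [circleNorm, Real.zero_rpow hp.ne', Real.zero_rpow (inv_pos.mpr hp).ne']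

section Dyadic

variable {p D r : ℝ} {J : ℕ}

lemma circleNorm_rampSum_le (hp : 1 ≤ p) (hD : 1 ≤ D) (hr : 1 < r)
    (hT : ∀ j < J, ∀ a, circleNorm p (tentSum (2 ^ j) a) ≤ D * r ^ j) {k : ℕ} (hk : k ≤ J)
    (a : ℝ) : circleNorm p (rampSum (2 ^ k) a) ≤ D * r ^ k / (r - 1) := by
  have hr1 : 0 < r - 1 := by linarith
  induction k generalizing a with
  | zero =>
    have h1 : rampSum (2 ^ 0) a = fun _ => 0 := by ext x; simp [rampSum]
    rw [h1, circleNorm_zero (by linarith)]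
    positivity
  | succ k ih =>
    have h1 : rampSum (2 ^ (k + 1)) a = fun x =>
        1 / 2 * tentSum (2 ^ k) (a + 1) x + rampSum (2 ^ k) (a + (2 ^ k : ℕ)) x := by
      ext x
      rw [pow_succ', rampSum_two_mul (by positivity)]
    have hc : Continuous fun x => (1 / 2 : ℂ) * tentSum (2 ^ k) (a + 1) x :=
      continuous_const.mul (continuous_tentSum _ _)
    rw [h1]
    refine (circleNorm_add_le hp hc (continuous_rampSum _ _)).trans ?_
    rw [circleNorm_const_mul (by linarith)]
    have h2 := hT k (by omega) (a + 1)
    have h3 := ih (by omega) (a + (2 ^ k : ℕ))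
    have h4 : 0 < D * r ^ k := by positivity
    have h5 : D * r ^ (k + 1) / (r - 1) = D * r ^ k + D * r ^ k / (r - 1) := by
      field_simp
      ring
    have h6 : ‖(1 / 2 : ℂ)‖ = 1 / 2 := by norm_num
    rw [h5, h6]
    linarith

lemma circleNorm_intervalSum_two_pow_le (hp : 1 ≤ p) (hD : 1 ≤ D) (hr : 1 < r)
    (hT : ∀ j < J, ∀ a, circleNorm p (tentSum (2 ^ j) a) ≤ D * r ^ j) {k : ℕ} (hk : k ≤ J)
    (a : ℝ) : circleNorm p (intervalSum (2 ^ k) a) ≤ (2 / (r - 1) + 1) * (D * r ^ k) := by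
  have h1 : intervalSum (2 ^ k) a = fun x => rampSum (2 ^ k) a x +
      (rampSum (2 ^ k) (-a - (2 ^ k : ℕ)) x + unitPhase (a ^ 2 * x)) := by
    ext x
    exact intervalSum_eq_rampSum_add (by positivity) a x
  have hc : Continuous fun x =>
      rampSum (2 ^ k) (-a - (2 ^ k : ℕ)) x + unitPhase (a ^ 2 * x) :=
    (continuous_rampSum _ _).add (continuous_unitPhase_mul _)
  rw [h1]
  refine (circleNorm_add_le hp (continuous_rampSum _ _) hc).trans ?_
  have h2 := circleNorm_add_le hp (continuous_rampSum (2 ^ k) (-a - (2 ^ k : ℕ)))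
    (continuous_unitPhase_mul (a ^ 2))
  rw [circleNorm_unitPhase] at h2
  have h3 := circleNorm_rampSum_le hp hD hr hT hk a
  have h4 := circleNorm_rampSum_le hp hD hr hT hk (-a - (2 ^ k : ℕ))
  have h5 : 1 ≤ D * r ^ k := one_le_mul_of_one_le_of_one_le hD (one_le_pow₀ hr.le)
  have h6 : (2 / (r - 1) + 1) * (D * r ^ k) =
      D * r ^ k / (r - 1) + D * r ^ k / (r - 1) + D * r ^ k := by ring
  linarith

lemma circleNorm_intervalSum_le (hp : 1 ≤ p) (hD : 1 ≤ D) (hr : 1 < r)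
    (hT : ∀ j < J, ∀ a, circleNorm p (tentSum (2 ^ j) a) ≤ D * r ^ j) {k : ℕ} (hk : k ≤ J + 1)
    {n : ℕ} (hn : n < 2 ^ k) (a : ℝ) :
    circleNorm p (intervalSum n a) ≤ (2 / (r - 1) + 1) * (D * r ^ k) / (r - 1) := by
  have hr1 : 0 < r - 1 := by linarith
  induction k generalizing n a with
  | zero =>
    have h0 : n = 0 := by simpa using hn
    have h1 : intervalSum n a = fun _ => 0 := by ext x; simp [intervalSum, h0]
    rw [h1, circleNorm_zero (by linarith)]
    positivity
  | succ k ih =>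
    have h5 : (2 / (r - 1) + 1) * (D * r ^ (k + 1)) / (r - 1) =
        (2 / (r - 1) + 1) * (D * r ^ k) + (2 / (r - 1) + 1) * (D * r ^ k) / (r - 1) := by
      field_simp
      ring
    rw [h5]
    rcases lt_or_ge n (2 ^ k) with h | h
    · have h6 : 0 ≤ (2 / (r - 1) + 1) * (D * r ^ k) := by positivity
      linarith [ih (by omega) h a]
    · obtain ⟨m, rfl⟩ := Nat.exists_eq_add_of_le h
      have h1 : intervalSum (2 ^ k + m) a = fun x =>
          intervalSum (2 ^ k) a x + intervalSum m (a + (2 ^ k : ℕ)) x := by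
        ext x
        exact intervalSum_add _ _ _ _
      rw [h1]
      refine (circleNorm_add_le hp (continuous_intervalSum _ _)
        (continuous_intervalSum _ _)).trans ?_
      have h2 := circleNorm_intervalSum_two_pow_le hp hD hr hT (k := k) (by omega) a
      have h3 := ih (by omega) (n := m) (by rw [pow_succ] at hn; omega) (a + (2 ^ k : ℕ))
      linarith

end Dyadic

lemma weylSum_eq_intervalSum (N : ℕ) : weylSum N = intervalSum N 1 := by
  ext x
  rw [weylSum, intervalSum, ← Finset.Ico_add_one_right_eq_Icc, Finset.sum_Ico_eq_sum_range]
  refine Finset.sum_congr rfl fun i _ => ?_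
  rw [unitPhase]
  congr 1
  push_cast
  ring

lemma exists_integral_weylSum_le {p σ : ℝ} (hp : 1 ≤ p) (hσ : 0 < σ) :
    ∃ C > 0, ∀ N : ℕ, 0 < N → ∀ A : ℝ, 1 ≤ A →
      (∀ K : ℕ, 0 < K → K ≤ N → ∀ a, ∫ x in (0 : ℝ)..1, ‖tentSum K a x‖ ^ p ≤ A * (K : ℝ) ^ σ) →
      ∫ x in (0 : ℝ)..1, ‖weylSum N x‖ ^ p ≤ C * (A * (N : ℝ) ^ σ) := by
  have hp0 : 0 < p := by linarith
  set r : ℝ := 2 ^ (σ / p) with hr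
  have hr1 : 1 < r := Real.one_lt_rpow one_lt_two (by positivity)
  have hr2 : 0 < r - 1 := by linarith
  refine ⟨((2 / (r - 1) + 1) * r / (r - 1)) ^ p, by positivity, fun N hN A hA hT => ?_⟩
  have hA0 : 0 ≤ A := by linarith
  have hD : 1 ≤ A ^ p⁻¹ := Real.one_le_rpow hA (by positivity)
  have hrk : ∀ k : ℕ, r ^ k = (((2 ^ k : ℕ) : ℝ) ^ σ) ^ p⁻¹ := fun k => by
    rw [hr, ← Real.rpow_mul (by positivity), ← div_eq_mul_inv, ← Real.rpow_natCast,
      ← Real.rpow_mul zero_le_two, mul_comm, Real.rpow_mul zero_le_two, Real.rpow_natCast]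
    norm_num
  have h2N : 2 ^ Nat.log 2 N ≤ N := Nat.pow_log_le_self 2 hN.ne'
  have hT' : ∀ j < Nat.log 2 N, ∀ a, circleNorm p (tentSum (2 ^ j) a) ≤ A ^ p⁻¹ * r ^ j := by
    intro j hj a
    rw [hrk, ← Real.mul_rpow hA0 (by positivity)]
    refine Real.rpow_le_rpow (intervalIntegral.integral_nonneg zero_le_one
      fun x _ => by positivity) (hT _ (by positivity) ?_ a) (by positivity)
    exact (Nat.pow_le_pow_right two_pos hj.le).trans h2N
  have h1 := circleNorm_intervalSum_le hp hD hr1 hT' le_rfl (Nat.lt_pow_succ_log_self one_lt_two N) 1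
  rw [← weylSum_eq_intervalSum, circleNorm] at h1
  have h2 : r ^ (Nat.log 2 N + 1) ≤ r * ((N : ℝ) ^ σ) ^ p⁻¹ := by
    rw [pow_succ', hrk]
    have : ((2 ^ Nat.log 2 N : ℕ) : ℝ) ≤ N := Nat.cast_le.mpr h2N
    gcongr
  have h3 : (2 / (r - 1) + 1) * (A ^ p⁻¹ * r ^ (Nat.log 2 N + 1)) / (r - 1) ≤
      (2 / (r - 1) + 1) * r / (r - 1) * (A * (N : ℝ) ^ σ) ^ p⁻¹ := by
    rw [Real.mul_rpow hA0 (by positivity)]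
    have h4 : (2 / (r - 1) + 1) * r / (r - 1) * (A ^ p⁻¹ * ((N : ℝ) ^ σ) ^ p⁻¹) =
        (2 / (r - 1) + 1) * (A ^ p⁻¹ * (r * ((N : ℝ) ^ σ) ^ p⁻¹)) / (r - 1) := by ring
    rw [h4]
    gcongr
  have hI : 0 ≤ ∫ x in (0 : ℝ)..1, ‖weylSum N x‖ ^ p :=
    intervalIntegral.integral_nonneg zero_le_one fun x _ => by positivity
  have h5 := Real.rpow_le_rpow (by positivity) (h1.trans h3) hp0.le
  rwa [Real.rpow_inv_rpow hI hp0.ne', Real.mul_rpow (by positivity) (by positivity),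
    Real.rpow_inv_rpow (by positivity) hp0.ne'] at h5

lemma exists_integral_weylSum_rpow_le_of_lt_four {p : ℝ} (hp : 2 < p) (hp' : p < 4) :
    ∃ C > 0, ∀ N : ℕ, 0 < N → ∫ x in (0 : ℝ)..1, ‖weylSum N x‖ ^ p ≤ C * (N : ℝ) ^ (p / 2) := by
  obtain ⟨C₁, hC₁, h₁⟩ := exists_integral_tentSum_rpow_le hp
  obtain ⟨C₂, hC₂, h₂⟩ := exists_integral_weylSum_le (p := p) (σ := p / 2) (by linarith)
    (by linarith)
  set B : ℝ := C₁ * ((1 - (p / 2 - 1))⁻¹ * 4 ^ (1 - (p / 2 - 1)))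
  refine ⟨C₂ * max 1 B, by positivity, fun N hN => ?_⟩
  rw [mul_assoc]
  refine h₂ N hN _ (le_max_left _ _) fun K hK _ a => (h₁ K hK a).trans ?_
  have hK0 : (0 : ℝ) < K := Nat.cast_pos.mpr hK
  have h3 := sum_Icc_rpow_neg_le (α := p / 2 - 1) (by linarith) (by linarith) (4 * K)
  rw [show -(p / 2 - 1) = 1 - p / 2 by ring] at h3
  have h4 : C₁ * ((K : ℝ) ^ (p - 2) * ((1 - (p / 2 - 1))⁻¹ *
      ((4 * K : ℕ) : ℝ) ^ (1 - (p / 2 - 1)))) = B * (K : ℝ) ^ (p / 2) := by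
    have h5 : (K : ℝ) ^ (p / 2) = (K : ℝ) ^ (p - 2) * (K : ℝ) ^ (1 - (p / 2 - 1)) := by
      rw [← Real.rpow_add hK0]
      ring_nf
    push_cast
    rw [Real.mul_rpow (by norm_num) hK0.le, h5]
    ring
  refine le_trans (mul_le_mul_of_nonneg_left (mul_le_mul_of_nonneg_left h3 (by positivity))
    hC₁.le) (h4.le.trans ?_)
  gcongr
  exact le_max_right _ _

lemma exists_integral_weylSum_rpow_four_le :
    ∃ C > 0, ∀ N : ℕ, 3 ≤ N →
      ∫ x in (0 : ℝ)..1, ‖weylSum N x‖ ^ (4 : ℝ) ≤ C * ((N : ℝ) ^ 2 * Real.log N) := by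
  obtain ⟨C₁, hC₁, h₁⟩ := exists_integral_tentSum_rpow_le (p := 4) (by norm_num)
  obtain ⟨C₂, hC₂, h₂⟩ := exists_integral_weylSum_le (p := 4) (σ := 2) (by norm_num) two_pos
  refine ⟨C₂ * max 1 (C₁ * (2 + Real.log 4)), by positivity, fun N hN => ?_⟩
  have hN1 : 1 ≤ Real.log N := by
    rw [Real.le_log_iff_exp_le (by positivity)]
    have : (3 : ℝ) ≤ N := by exact_mod_cast hN
    linarith [Real.exp_one_lt_d9]
  have hB : 1 ≤ max 1 (C₁ * (2 + Real.log 4)) := le_max_left _ _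
  have h3 := h₂ N (by omega) (max 1 (C₁ * (2 + Real.log 4)) * Real.log N)
    (one_le_mul_of_one_le_of_one_le hB hN1) fun K hK hKN a => ?_
  · rw [Real.rpow_two] at h3
    calc _ ≤ _ := h3
      _ = _ := by ring
  · refine (h₁ K hK a).trans ?_
    have hK0 : (0 : ℝ) < K := Nat.cast_pos.mpr hK
    have h4 : ∑ q ∈ Finset.Icc 1 (4 * K), (q : ℝ) ^ (1 - (4 : ℝ) / 2) ≤
        (2 + Real.log 4) * Real.log N := by
      have h5 := harmonic_le_one_add_log (4 * K)
      rw [harmonic_eq_sum_Icc] at h5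
      push_cast at h5
      have h6 : ∑ q ∈ Finset.Icc 1 (4 * K), (q : ℝ) ^ (1 - (4 : ℝ) / 2) =
          ∑ q ∈ Finset.Icc 1 (4 * K), (q : ℝ)⁻¹ := by
        refine Finset.sum_congr rfl fun q _ => ?_
        rw [show 1 - (4 : ℝ) / 2 = -1 by norm_num, Real.rpow_neg_one]
      rw [Real.log_mul (by norm_num) hK0.ne'] at h5
      have h7 : Real.log K ≤ Real.log N := Real.log_le_log hK0 (Nat.cast_le.mpr hKN)
      have h8 : 0 < Real.log 4 := Real.log_pos (by norm_num)
      rw [h6]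
      nlinarith
    rw [show (4 : ℝ) - 2 = 2 by norm_num]
    calc C₁ * ((K : ℝ) ^ (2 : ℝ) * ∑ q ∈ Finset.Icc 1 (4 * K), (q : ℝ) ^ (1 - (4 : ℝ) / 2))
        ≤ C₁ * ((K : ℝ) ^ (2 : ℝ) * ((2 + Real.log 4) * Real.log N)) := by gcongr
      _ = C₁ * (2 + Real.log 4) * Real.log N * (K : ℝ) ^ (2 : ℝ) := by ring
      _ ≤ _ := by
        gcongr
        exact le_max_right _ _

lemma exists_integral_weylSum_rpow_le_of_four_lt {p : ℝ} (hp : 4 < p) :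
    ∃ C > 0, ∀ N : ℕ, 0 < N → ∫ x in (0 : ℝ)..1, ‖weylSum N x‖ ^ p ≤ C * (N : ℝ) ^ (p - 2) := by
  obtain ⟨C₁, hC₁, h₁⟩ := exists_integral_tentSum_rpow_le (p := p) (by linarith)
  obtain ⟨C₂, hC₂, h₂⟩ := exists_integral_weylSum_le (p := p) (σ := p - 2) (by linarith)
    (by linarith)
  have hs : Summable fun q : ℕ => (q : ℝ) ^ (1 - p / 2) :=
    Real.summable_nat_rpow.mpr (by linarith)
  refine ⟨C₂ * max 1 (C₁ * ∑' q : ℕ, (q : ℝ) ^ (1 - p / 2)), by positivity, fun N hN => ?_⟩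
  rw [mul_assoc]
  refine h₂ N hN _ (le_max_left _ _) fun K hK _ a => (h₁ K hK a).trans ?_
  have h3 := hs.sum_le_tsum (Finset.Icc 1 (4 * K)) fun q _ => by positivity
  calc C₁ * ((K : ℝ) ^ (p - 2) * ∑ q ∈ Finset.Icc 1 (4 * K), (q : ℝ) ^ (1 - p / 2))
      ≤ C₁ * ((K : ℝ) ^ (p - 2) * ∑' q : ℕ, (q : ℝ) ^ (1 - p / 2)) := by gcongr
    _ = C₁ * (∑' q : ℕ, (q : ℝ) ^ (1 - p / 2)) * (K : ℝ) ^ (p - 2) := by ring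
    _ ≤ _ := by
      gcongr
      exact le_max_right _ _

lemma continuous_weylSum (N : ℕ) : Continuous (weylSum N) := by
  rw [weylSum_eq_intervalSum]
  exact continuous_intervalSum N 1

lemma intervalIntegrable_norm_weylSum_rpow {p : ℝ} (hp : 0 ≤ p) (N : ℕ) :
    IntervalIntegrable (fun x => ‖weylSum N x‖ ^ p) volume 0 1 :=
  ((continuous_weylSum N).norm.rpow_const fun _ => Or.inr hp).intervalIntegrable 0 1

lemma exists_integral_weylSum_rpow_le_of_le_two {p : ℝ} (hp : 0 < p) (hp' : p ≤ 2) :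
    ∃ C > 0, ∀ N : ℕ, 0 < N → ∫ x in (0 : ℝ)..1, ‖weylSum N x‖ ^ p ≤ C * (N : ℝ) ^ (p / 2) := by
  obtain ⟨C₁, hC₁, h₁⟩ := exists_integral_weylSum_rpow_le_of_lt_four (p := 3) (by norm_num)
    (by norm_num)
  refine ⟨1 + C₁, by positivity, fun N hN => ?_⟩
  have hN0 : (0 : ℝ) < N := Nat.cast_pos.mpr hN
  have h2 : ∀ x ∈ Set.Icc (0 : ℝ) 1, ‖weylSum N x‖ ^ p ≤ (N : ℝ) ^ (p / 2) +
      (N : ℝ) ^ (p / 2 - 3 / 2) * ‖weylSum N x‖ ^ (3 : ℝ) := by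
    intro x _
    set t := ‖weylSum N x‖
    have ht : 0 ≤ t := norm_nonneg _
    rcases le_total t ((N : ℝ) ^ (1 / 2 : ℝ)) with h | h
    · have h3 := Real.rpow_le_rpow ht h hp.le
      rw [← Real.rpow_mul hN0.le, show 1 / 2 * p = p / 2 by ring] at h3
      have : 0 ≤ (N : ℝ) ^ (p / 2 - 3 / 2) * t ^ (3 : ℝ) := by positivity
      linarith
    · have ht0 : 0 < t := lt_of_lt_of_le (by positivity) h
      have h3 := Real.rpow_le_rpow_of_nonpos (by positivity) h (show p - 3 ≤ 0 by linarith)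
      rw [← Real.rpow_mul hN0.le, show 1 / 2 * (p - 3) = p / 2 - 3 / 2 by ring] at h3
      have h4 : t ^ p = t ^ (p - 3) * t ^ (3 : ℝ) := by
        rw [← Real.rpow_add ht0]
        ring_nf
      have h5 : t ^ p ≤ (N : ℝ) ^ (p / 2 - 3 / 2) * t ^ (3 : ℝ) := by
        rw [h4]
        gcongr
      have : 0 ≤ (N : ℝ) ^ (p / 2) := by positivity
      linarith
  have h3 := intervalIntegrable_norm_weylSum_rpow (p := 3) (by norm_num) N
  have h4 := intervalIntegral.integral_mono_on zero_le_one
    (intervalIntegrable_norm_weylSum_rpow hp.le N)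
    (intervalIntegrable_const.add (h3.const_mul _)) h2
  refine h4.trans ?_
  rw [intervalIntegral.integral_add intervalIntegrable_const (h3.const_mul _),
    intervalIntegral.integral_const_mul, intervalIntegral.integral_const, sub_zero, one_smul]
  have h5 : (N : ℝ) ^ (p / 2) = (N : ℝ) ^ (p / 2 - 3 / 2) * (N : ℝ) ^ ((3 : ℝ) / 2) := by
    rw [← Real.rpow_add hN0]
    ring_nf
  have h6 : (N : ℝ) ^ (p / 2 - 3 / 2) * ∫ x in (0 : ℝ)..1, ‖weylSum N x‖ ^ (3 : ℝ) ≤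
      (N : ℝ) ^ (p / 2 - 3 / 2) * (C₁ * (N : ℝ) ^ ((3 : ℝ) / 2)) := by
    gcongr
    exact h₁ N hN
  linear_combination h6 - C₁ * h5

lemma integral_unitPhase_intCast_mul (k : ℤ) :
    ∫ x in (0 : ℝ)..1, unitPhase (k * x) = if k = 0 then 1 else 0 := by
  split_ifs with hk
  · simp [hk, unitPhase_zero]
  · have h1 : (2 * π * k * Complex.I : ℂ) ≠ 0 := by
      simp [Real.pi_ne_zero, hk]
    have h2 : ∀ x : ℝ, unitPhase (k * x) = Complex.exp (2 * π * k * Complex.I * x) := fun x => by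
      rw [unitPhase]
      congr 1
      push_cast
      ring
    have h3 : Complex.exp (2 * π * k * Complex.I) = 1 :=
      Complex.exp_eq_one_iff.mpr ⟨k, by ring⟩
    simp only [h2]
    rw [integral_exp_mul_complex h1]
    simp [h3]

lemma integral_norm_sum_unitPhase_sq {ι : Type*} (S : Finset ι) (φ : ι → ℤ) :
    ∫ x in (0 : ℝ)..1, ‖∑ s ∈ S, unitPhase (φ s * x)‖ ^ 2 =
      ((S ×ˢ S).filter fun z => φ z.1 = φ z.2).card := by
  have h1 : ∀ x : ℝ, ((‖∑ s ∈ S, unitPhase (φ s * x)‖ ^ 2 : ℝ) : ℂ) =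
      ∑ z ∈ S ×ˢ S, unitPhase ((φ z.1 - φ z.2 : ℤ) * x) := fun x => by
    push_cast
    rw [← Complex.mul_conj', map_sum, Finset.sum_mul_sum, Finset.sum_product]
    refine Finset.sum_congr rfl fun s _ => Finset.sum_congr rfl fun t _ => ?_
    rw [conj_unitPhase, ← unitPhase_add]
    congr 1
    ring
  have h2 : ((∫ x in (0 : ℝ)..1, ‖∑ s ∈ S, unitPhase (φ s * x)‖ ^ 2 : ℝ) : ℂ) =
      ((S ×ˢ S).filter fun z => φ z.1 = φ z.2).card := by
    rw [← intervalIntegral.integral_ofReal]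
    simp only [h1]
    rw [intervalIntegral.integral_finsetSum fun z _ =>
      (continuous_unitPhase_mul _).intervalIntegrable _ _]
    simp only [integral_unitPhase_intCast_mul, sub_eq_zero, Finset.sum_boole]
  exact_mod_cast h2

lemma weylSum_eq_sum_unitPhase (N : ℕ) (x : ℝ) :
    weylSum N x = ∑ m ∈ Finset.Icc 1 N, unitPhase (((m : ℤ) ^ 2 : ℤ) * x) := by
  refine Finset.sum_congr rfl fun m _ => ?_
  rw [unitPhase]
  congr 1
  push_cast
  ring

lemma integral_norm_weylSum_sq (N : ℕ) : ∫ x in (0 : ℝ)..1, ‖weylSum N x‖ ^ 2 = N := by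
  simp only [weylSum_eq_sum_unitPhase]
  rw [integral_norm_sum_unitPhase_sq (Finset.Icc 1 N) fun m => (m : ℤ) ^ 2]
  have h1 : ((Finset.Icc 1 N ×ˢ Finset.Icc 1 N).filter
      fun z => ((z.1 : ℕ) : ℤ) ^ 2 = ((z.2 : ℕ) : ℤ) ^ 2) = (Finset.Icc 1 N).diag := by
    ext ⟨m, n⟩
    simp only [Finset.mem_filter, Finset.mem_product, Finset.mem_diag, Finset.mem_Icc]
    constructor
    · rintro ⟨⟨hm, hn⟩, h⟩
      refine ⟨hm, ?_⟩
      exact_mod_cast (pow_left_inj₀ (by positivity) (by positivity) two_ne_zero).mp h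
    · rintro ⟨hm, rfl⟩
      exact ⟨⟨hm, hm⟩, rfl⟩
  rw [h1, Finset.diag_card, Nat.card_Icc, Nat.add_sub_cancel]

lemma integral_norm_weylSum_pow_four (N : ℕ) :
    ∫ x in (0 : ℝ)..1, ‖weylSum N x‖ ^ 4 =
      ((((Finset.Icc 1 N ×ˢ Finset.Icc 1 N) ×ˢ (Finset.Icc 1 N ×ˢ Finset.Icc 1 N)).filter
        fun z => z.1.1 ^ 2 + z.1.2 ^ 2 = z.2.1 ^ 2 + z.2.2 ^ 2).card : ℝ) := by
  have h1 : ∀ x, ‖weylSum N x‖ ^ 4 = ‖∑ z ∈ Finset.Icc 1 N ×ˢ Finset.Icc 1 N,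
      unitPhase (((z.1 : ℤ) ^ 2 + (z.2 : ℤ) ^ 2 : ℤ) * x)‖ ^ 2 := fun x => by
    rw [show 4 = 2 * 2 from rfl, pow_mul, ← norm_pow, sq (weylSum N x), weylSum_eq_sum_unitPhase,
      Finset.sum_mul_sum, Finset.sum_product]
    congr 2
    refine Finset.sum_congr rfl fun m _ => Finset.sum_congr rfl fun n _ => ?_
    rw [← unitPhase_add]
    congr 1
    push_cast
    ring
  simp only [h1]
  rw [integral_norm_sum_unitPhase_sq (Finset.Icc 1 N ×ˢ Finset.Icc 1 N)
    fun z => (z.1 : ℤ) ^ 2 + (z.2 : ℤ) ^ 2]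
  norm_cast

lemma intervalIntegrable_norm_weylSum_sq (N : ℕ) :
    IntervalIntegrable (fun x => ‖weylSum N x‖ ^ 2) volume 0 1 :=
  ((continuous_weylSum N).norm.pow 2).intervalIntegrable 0 1

lemma exists_le_integral_weylSum_rpow_of_lt_two {p : ℝ} (hp : 0 < p) (hp' : p < 2) :
    ∃ c > 0, ∀ N : ℕ, 0 < N → c * (N : ℝ) ^ (p / 2) ≤ ∫ x in (0 : ℝ)..1, ‖weylSum N x‖ ^ p := by
  obtain ⟨C₁, hC₁, h₁⟩ := exists_integral_weylSum_rpow_le_of_lt_four (p := 3) (by norm_num)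
    (by norm_num)
  refine ⟨((2 * C₁) ^ (2 - p))⁻¹ / 2, by positivity, fun N hN => ?_⟩
  have hN0 : (0 : ℝ) < N := Nat.cast_pos.mpr hN
  set B : ℝ := 2 * C₁ * (N : ℝ) ^ (1 / 2 : ℝ) with hB
  have hB0 : 0 < B := by positivity
  have h2 : ∀ x ∈ Set.Icc (0 : ℝ) 1, ‖weylSum N x‖ ^ 2 ≤
      B ^ (2 - p) * ‖weylSum N x‖ ^ p + B⁻¹ * ‖weylSum N x‖ ^ (3 : ℝ) := by
    intro x _
    set t := ‖weylSum N x‖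
    have ht : 0 ≤ t := norm_nonneg _
    have h5 : t ^ (3 : ℝ) = t ^ 3 := by norm_cast
    rcases ht.eq_or_lt with h0 | ht0
    · rw [← h0, zero_pow two_ne_zero]
      positivity
    rcases le_total t B with h | h
    · have h3 : t ^ 2 ≤ B ^ (2 - p) * t ^ p := by
        calc t ^ 2 = t ^ (2 - p) * t ^ p := by rw [← Real.rpow_add ht0]; norm_num
          _ ≤ _ := by
            gcongr
      have : 0 ≤ B⁻¹ * t ^ (3 : ℝ) := by positivity
      linarith
    · have h3 : t ^ 2 ≤ B⁻¹ * t ^ (3 : ℝ) := by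
        rw [h5, inv_mul_eq_div, le_div_iff₀ hB0, pow_succ t 2]
        gcongr
      have : 0 ≤ B ^ (2 - p) * t ^ p := by positivity
      linarith
  have hi2 := intervalIntegrable_norm_weylSum_rpow hp.le N
  have hi3 := intervalIntegrable_norm_weylSum_rpow (p := 3) (by norm_num) N
  have h4 := intervalIntegral.integral_mono_on zero_le_one
    (intervalIntegrable_norm_weylSum_sq N) ((hi2.const_mul _).add (hi3.const_mul _)) h2
  rw [integral_norm_weylSum_sq, intervalIntegral.integral_add (hi2.const_mul _) (hi3.const_mul _),
    intervalIntegral.integral_const_mul, intervalIntegral.integral_const_mul] at h4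
  have h5 : B⁻¹ * ∫ x in (0 : ℝ)..1, ‖weylSum N x‖ ^ (3 : ℝ) ≤ N / 2 := by
    have h6 : B⁻¹ * (C₁ * (N : ℝ) ^ ((3 : ℝ) / 2)) = N / 2 := by
      have h7 : (N : ℝ) ^ ((3 : ℝ) / 2) = N * (N : ℝ) ^ (1 / 2 : ℝ) := by
        rw [← Real.rpow_one_add' hN0.le (by norm_num)]
        norm_num
      rw [h7, hB]
      field_simp
    rw [← h6]
    gcongr
    exact h₁ N hN
  have h6 : ((2 * C₁) ^ (2 - p))⁻¹ / 2 * (N : ℝ) ^ (p / 2) = (B ^ (2 - p))⁻¹ * (N / 2) := by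
    have h7 : (N : ℝ) = (N : ℝ) ^ (1 / 2 * (2 - p)) * (N : ℝ) ^ (p / 2) := by
      rw [← Real.rpow_add hN0]
      ring_nf
      simp
    have h8 : B ^ (2 - p) = (2 * C₁) ^ (2 - p) * (N : ℝ) ^ (1 / 2 * (2 - p)) := by
      rw [hB, Real.mul_rpow (x := 2 * C₁) (by positivity) (by positivity), ← Real.rpow_mul hN0.le]
    have h9 : (N : ℝ) / 2 = (N : ℝ) ^ (1 / 2 * (2 - p)) * (N : ℝ) ^ (p / 2) / 2 := by rw [← h7]
    rw [h8, h9]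
    field_simp
  rw [h6, inv_mul_le_iff₀ (by positivity)]
  linarith

lemma le_integral_weylSum_rpow_of_two_le {p : ℝ} (hp : 2 ≤ p) {N : ℕ} (hN : 0 < N) :
    ((N : ℝ) / 2) ^ (p / 2) ≤ ∫ x in (0 : ℝ)..1, ‖weylSum N x‖ ^ p := by
  have hM : (0 : ℝ) < N / 2 := by positivity
  have h2 : ∀ x ∈ Set.Icc (0 : ℝ) 1, ‖weylSum N x‖ ^ 2 ≤
      N / 2 + ((N : ℝ) / 2) ^ (1 - p / 2) * ‖weylSum N x‖ ^ p := by
    intro x _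
    set t := ‖weylSum N x‖
    have ht : 0 ≤ t := norm_nonneg _
    rcases le_total (t ^ 2) (N / 2) with h | h
    · have : 0 ≤ ((N : ℝ) / 2) ^ (1 - p / 2) * t ^ p := by positivity
      linarith
    · have h3 := Real.rpow_le_rpow_of_nonpos hM h (show 1 - p / 2 ≤ 0 by linarith)
      have ht0 : 0 < t := by
        rcases ht.eq_or_lt with h0 | h0
        · rw [← h0] at h
          linarith [zero_pow (M₀ := ℝ) two_ne_zero]
        · exact h0
      have h4 : t ^ 2 = (t ^ 2) ^ (1 - p / 2) * t ^ p := by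
        rw [← Real.rpow_natCast, ← Real.rpow_mul ht, ← Real.rpow_add ht0]
        congr 1
        push_cast
        ring
      have h5 : (t ^ 2) ^ (1 - p / 2) * t ^ p ≤ ((N : ℝ) / 2) ^ (1 - p / 2) * t ^ p := by
        gcongr
      linarith
  have hi := intervalIntegrable_norm_weylSum_rpow (p := p) (by linarith) N
  have h4 := intervalIntegral.integral_mono_on zero_le_one
    (intervalIntegrable_norm_weylSum_sq N) (intervalIntegrable_const.add (hi.const_mul _)) h2
  rw [integral_norm_weylSum_sq, intervalIntegral.integral_add intervalIntegrable_const
    (hi.const_mul _), intervalIntegral.integral_const_mul, intervalIntegral.integral_const,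
    sub_zero, one_smul] at h4
  have h5 : ((N : ℝ) / 2) ^ (1 - p / 2) * ((N : ℝ) / 2) ^ (p / 2) = N / 2 := by
    rw [← Real.rpow_add hM]
    simp
  refine le_of_mul_le_mul_left ?_ (Real.rpow_pos_of_pos hM (1 - p / 2))
  rw [h5]
  linarith

lemma half_le_norm_weylSum {N : ℕ} (hN : 0 < N) {x : ℝ} (hx0 : 0 ≤ x)
    (hx : x ≤ (8 * (N : ℝ) ^ 2)⁻¹) : (N : ℝ) / 2 ≤ ‖weylSum N x‖ := by
  refine le_trans ?_ (Complex.re_le_norm _)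
  rw [weylSum_eq_sum_unitPhase, Complex.re_sum]
  have h1 : ∀ m ∈ Finset.Icc 1 N, (1 / 2 : ℝ) ≤ (unitPhase (((m : ℤ) ^ 2 : ℤ) * x)).re := by
    intro m hm
    have hmN : (m : ℝ) ≤ N := Nat.cast_le.mpr (Finset.mem_Icc.mp hm).2
    have h2 : (m : ℝ) ^ 2 * x ≤ 1 / 8 := by
      have h3 : (m : ℝ) ^ 2 * x ≤ (N : ℝ) ^ 2 * (8 * (N : ℝ) ^ 2)⁻¹ := by gcongr
      have h4 : (N : ℝ) ^ 2 * (8 * (N : ℝ) ^ 2)⁻¹ = 1 / 8 := by field_simp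
      linarith
    have h3 : unitPhase (((m : ℤ) ^ 2 : ℤ) * x) =
        Complex.exp ((2 * π * ((m : ℝ) ^ 2 * x) : ℝ) * Complex.I) := by
      rw [unitPhase]
      congr 1
      push_cast
      ring
    rw [h3, Complex.exp_ofReal_mul_I_re, ← Real.cos_pi_div_three]
    have h4 : 0 ≤ (m : ℝ) ^ 2 * x := by positivity
    refine Real.cos_le_cos_of_nonneg_of_le_pi (by positivity) (by linarith [Real.pi_pos]) ?_
    nlinarith [Real.pi_pos]
  have h5 := Finset.card_nsmul_le_sum _ _ _ h1
  rw [Nat.card_Icc, Nat.add_sub_cancel, nsmul_eq_mul] at h5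
  linarith

lemma le_integral_weylSum_rpow {p : ℝ} (hp : 0 < p) {N : ℕ} (hN : 0 < N) :
    ((1 / 2 : ℝ) ^ p / 8) * (N : ℝ) ^ (p - 2) ≤ ∫ x in (0 : ℝ)..1, ‖weylSum N x‖ ^ p := by
  have hN1 : (1 : ℝ) ≤ N := Nat.one_le_cast.mpr hN
  have hN0 : (0 : ℝ) < N := by linarith
  set δ : ℝ := (8 * (N : ℝ) ^ 2)⁻¹ with hδ
  have hδ0 : 0 ≤ δ := by positivity
  have hδ1 : δ ≤ 1 := inv_le_one_of_one_le₀ (by nlinarith)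
  have hc : Continuous fun x => ‖weylSum N x‖ ^ p :=
    (continuous_weylSum N).norm.rpow_const fun _ => Or.inr hp.le
  have h1 : ∫ x in (0 : ℝ)..δ, ‖weylSum N x‖ ^ p ≤ ∫ x in (0 : ℝ)..1, ‖weylSum N x‖ ^ p :=
    intervalIntegral.integral_mono_interval le_rfl hδ0 hδ1
      (Filter.Eventually.of_forall fun x => by positivity) (hc.intervalIntegrable 0 1)
  have h2 : ∫ _ in (0 : ℝ)..δ, ((N : ℝ) / 2) ^ p ≤ ∫ x in (0 : ℝ)..δ, ‖weylSum N x‖ ^ p :=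
    intervalIntegral.integral_mono_on hδ0 intervalIntegrable_const (hc.intervalIntegrable _ _)
      fun x hx => Real.rpow_le_rpow (by positivity) (half_le_norm_weylSum hN hx.1 hx.2) hp.le
  rw [intervalIntegral.integral_const, sub_zero, smul_eq_mul] at h2
  have h3 : ((1 / 2 : ℝ) ^ p / 8) * (N : ℝ) ^ (p - 2) = δ * ((N : ℝ) / 2) ^ p := by
    rw [hδ, div_eq_mul_one_div (N : ℝ) 2, Real.mul_rpow hN0.le (by norm_num),
      Real.rpow_sub hN0, Real.rpow_two]
    field_simp
  linarith

/-- Coprime pairs `(u, v)` with `1 ≤ u` and `2 * u ≤ v ≤ V`. -/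
def coprimePairs (V : ℕ) : Finset (ℕ × ℕ) :=
  (Finset.Icc 1 V ×ˢ Finset.Icc 1 V).filter fun w => 2 * w.1 ≤ w.2 ∧ w.1.Coprime w.2

lemma sum_div_two_div_sq_le (V : ℕ) :
    ∑ v ∈ Finset.Icc 1 V, ((v / 2 : ℕ) : ℝ) / (v : ℝ) ^ 2 ≤
      2 * ∑ w ∈ coprimePairs V, 1 / (w.2 : ℝ) ^ 2 := by
  set P := (Finset.Icc 1 V).sigma fun v => Finset.Icc 1 (v / 2) with hP
  set Q := Finset.Icc 1 V ×ˢ coprimePairs V with hQ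
  have h1 : ∑ v ∈ Finset.Icc 1 V, ((v / 2 : ℕ) : ℝ) / (v : ℝ) ^ 2 =
      ∑ z ∈ P, 1 / (z.1 : ℝ) ^ 2 := by
    rw [hP, Finset.sum_sigma]
    refine Finset.sum_congr rfl fun v _ => ?_
    dsimp only
    rw [Finset.sum_const, Nat.card_Icc, Nat.add_sub_cancel, nsmul_eq_mul, mul_one_div]
  let φ : ℕ × ℕ × ℕ → Σ _ : ℕ, ℕ := fun z => ⟨z.1 * z.2.2, z.1 * z.2.1⟩
  have h2 : P ⊆ Q.image φ := by
    rintro ⟨v, u⟩ hz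
    simp only [hP, Finset.mem_sigma, Finset.mem_Icc] at hz
    obtain ⟨⟨hv1, hvV⟩, hu1, hu⟩ := hz
    obtain ⟨g, u', v', hg, hco, hu', hv'⟩ := Nat.exists_coprime' (m := u) (n := v)
      (Nat.gcd_pos_of_pos_left _ hu1)
    have hu0 : 0 < u' := by
      rcases Nat.eq_zero_or_pos u' with h | h
      · simp [h] at hu'; omega
      · exact h
    have hv0 : 0 < v' := by
      rcases Nat.eq_zero_or_pos v' with h | h
      · simp [h] at hv'; omega
      · exact h
    have huv : 2 * u' ≤ v' := by
      have : 2 * u ≤ v := by omega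
      rw [hu', hv', ← mul_assoc] at this
      exact Nat.le_of_mul_le_mul_right this hg
    have hgv : g ≤ v := hv' ▸ Nat.le_mul_of_pos_left g hv0
    have hvv : v' ≤ v := hv' ▸ Nat.le_mul_of_pos_right v' hg
    refine Finset.mem_image.mpr ⟨(g, u', v'), ?_, ?_⟩
    · simp only [hQ, coprimePairs, Finset.mem_product, Finset.mem_filter, Finset.mem_Icc]
      exact ⟨⟨hg, by omega⟩, ⟨⟨by omega, by omega⟩, by omega, by omega⟩, huv, hco⟩
    · simp only [φ, hu', hv', mul_comm g]
  have h3 : ∑ z ∈ Q.image φ, 1 / (z.1 : ℝ) ^ 2 ≤ ∑ z ∈ Q, 1 / ((φ z).1 : ℝ) ^ 2 :=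
    Finset.sum_image_le_of_nonneg fun _ _ => by positivity
  have h4 : ∑ z ∈ Q, 1 / ((φ z).1 : ℝ) ^ 2 =
      (∑ t ∈ Finset.Icc 1 V, 1 / (t : ℝ) ^ 2) * ∑ w ∈ coprimePairs V, 1 / (w.2 : ℝ) ^ 2 := by
    rw [Finset.sum_mul_sum, hQ, Finset.sum_product]
    refine Finset.sum_congr rfl fun t _ => Finset.sum_congr rfl fun w _ => ?_
    simp only [φ]
    push_cast
    rw [mul_pow, one_div_mul_one_div]
  have h5 : ∑ t ∈ Finset.Icc 1 V, 1 / (t : ℝ) ^ 2 ≤ 2 := by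
    rw [← Finset.Ico_add_one_right_eq_Icc]
    exact sum_Ico_one_div_sq_le (V + 1)
  have h6 : 0 ≤ ∑ w ∈ coprimePairs V, 1 / (w.2 : ℝ) ^ 2 :=
    Finset.sum_nonneg fun _ _ => by positivity
  rw [h1]
  refine (Finset.sum_le_sum_of_subset_of_nonneg h2 fun _ _ _ => by positivity).trans
    (h3.trans (h4.le.trans ?_))
  gcongr

lemma log_sub_one_le_sum_coprimePairs (V : ℕ) :
    (Real.log (V + 1) - 1) / 6 ≤ ∑ w ∈ coprimePairs V, 1 / (w.2 : ℝ) ^ 2 := by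
  have h1 := log_add_one_le_harmonic V
  rw [harmonic_eq_sum_Icc] at h1
  push_cast at h1
  have h2 : ∑ v ∈ Finset.Icc 1 V, (v : ℝ)⁻¹ ≤
      1 + 3 * ∑ v ∈ Finset.Icc 1 V, ((v / 2 : ℕ) : ℝ) / (v : ℝ) ^ 2 := by
    rcases Nat.eq_zero_or_pos V with h0 | h0
    · simp [h0]
    rw [← Finset.add_sum_Ioc_eq_sum_Icc h0, ← Finset.add_sum_Ioc_eq_sum_Icc h0, mul_add,
      Finset.mul_sum]
    have h3 : ∑ v ∈ Finset.Ioc 1 V, (v : ℝ)⁻¹ ≤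
        ∑ v ∈ Finset.Ioc 1 V, 3 * (((v / 2 : ℕ) : ℝ) / (v : ℝ) ^ 2) := by
      refine Finset.sum_le_sum fun v hv => ?_
      have hv2 : 2 ≤ v := (Finset.mem_Ioc.mp hv).1
      have h4 : v ≤ 3 * (v / 2) := by omega
      have h5 : (v : ℝ) ≤ 3 * (v / 2 : ℕ) := by exact_mod_cast h4
      have hv0 : (0 : ℝ) < v := by positivity
      rw [← mul_div_assoc, le_div_iff₀ (by positivity), sq, inv_mul_cancel_left₀ hv0.ne']
      exact h5
    have h4 : ((1 / 2 : ℕ) : ℝ) = 0 := by norm_num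
    rw [h4]
    simp only [Nat.cast_one, inv_one, zero_div, mul_zero, zero_add]
    linarith
  linarith [sum_div_two_div_sq_le V]

lemma sum_coprimePairs_le_card (N : ℕ) :
    ∑ w ∈ coprimePairs (N / 4), (N / (4 * w.2)) ^ 2 ≤
      (((Finset.Icc 1 N ×ˢ Finset.Icc 1 N) ×ˢ (Finset.Icc 1 N ×ˢ Finset.Icc 1 N)).filter
        fun z => z.1.1 ^ 2 + z.1.2 ^ 2 = z.2.1 ^ 2 + z.2.2 ^ 2).card := by
  set G : ℕ × ℕ → ℕ := fun w => N / (4 * w.2)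
  set T := (coprimePairs (N / 4)).sigma fun w =>
    Finset.Ico (G w) (2 * G w) ×ˢ Finset.Ico (G w) (2 * G w)
  have hT : ∑ w ∈ coprimePairs (N / 4), (N / (4 * w.2)) ^ 2 = T.card := by
    rw [Finset.card_sigma]
    refine Finset.sum_congr rfl fun w _ => ?_
    rw [Finset.card_product, Nat.card_Ico, ← sq]
    congr 1
    change G w = _
    omega
  have hmem : ∀ u v g k : ℕ, (⟨(u, v), g, k⟩ : Σ _ : ℕ × ℕ, ℕ × ℕ) ∈ T →
      0 < u ∧ 0 < g ∧ u.Coprime v ∧ u * g < v * k ∧ u * k < v * g ∧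
        v * k + u * g ≤ N ∧ v * g + u * k ≤ N := by
    intro u v g k h
    simp only [T, coprimePairs, Finset.mem_sigma, Finset.mem_filter, Finset.mem_product,
      Finset.mem_Icc, Finset.mem_Ico] at h
    obtain ⟨⟨⟨⟨hu, -⟩, hv, hvN⟩, huv, hco⟩, ⟨hg, hg'⟩, hk, hk'⟩ := h
    have hG : 4 * (v * G (u, v)) ≤ N := by
      rw [← mul_assoc]
      exact Nat.mul_div_le N (4 * v)
    have h1 : 2 * u * g ≤ v * g := Nat.mul_le_mul_right g huv
    have h2 : 2 * u * k ≤ v * k := Nat.mul_le_mul_right k huv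
    have h3 : v * G (u, v) ≤ v * g := Nat.mul_le_mul_left v hg
    have h4 : v * G (u, v) ≤ v * k := Nat.mul_le_mul_left v hk
    have h5 : v * g < v * (2 * G (u, v)) := Nat.mul_lt_mul_of_pos_left hg' hv
    have h6 : v * k < v * (2 * G (u, v)) := Nat.mul_lt_mul_of_pos_left hk' hv
    refine ⟨hu, by omega, hco, ?_, ?_, ?_, ?_⟩ <;> nlinarith
  rw [hT]
  refine Finset.card_le_card_of_injOn (fun z =>
    ((z.1.2 * z.2.2 + z.1.1 * z.2.1, z.1.2 * z.2.1 - z.1.1 * z.2.2),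
      (z.1.2 * z.2.2 - z.1.1 * z.2.1, z.1.2 * z.2.1 + z.1.1 * z.2.2))) ?_ ?_
  · rintro ⟨⟨u, v⟩, g, k⟩ h
    obtain ⟨hu, hg, -, h1, h2, h3, h4⟩ := hmem u v g k h
    simp only [Finset.coe_filter, Set.mem_ofPred_eq, Finset.mem_product, Finset.mem_Icc]
    refine ⟨⟨⟨⟨by omega, by omega⟩, by omega, by omega⟩, ⟨by omega, by omega⟩, by omega, by omega⟩,
      ?_⟩
    zify [h1.le, h2.le]
    ring
  · rintro ⟨⟨u, v⟩, g, k⟩ h ⟨⟨u', v'⟩, g', k'⟩ h' heq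
    obtain ⟨hu, hg, hco, h1, h2, -, -⟩ := hmem u v g k h
    obtain ⟨hu', hg', hco', h1', h2', -, -⟩ := hmem u' v' g' k' h'
    simp only [Prod.mk.injEq] at heq
    obtain ⟨⟨e1, e2⟩, e3, e4⟩ := heq
    have f1 : u * g = u' * g' := by omega
    have f2 : v * g = v' * g' := by omega
    have f3 : u * k = u' * k' := by omega
    have hgg : g = g' := by
      have h5 := Nat.gcd_mul_right u g v
      have h6 := Nat.gcd_mul_right u' g' v'
      rw [hco.gcd_eq_one, one_mul] at h5
      rw [hco'.gcd_eq_one, one_mul] at h6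
      rw [← h5, ← h6, f1, f2]
    subst hgg
    obtain rfl := Nat.eq_of_mul_eq_mul_right hg f1
    obtain rfl := Nat.eq_of_mul_eq_mul_right hg f2
    obtain rfl := Nat.eq_of_mul_eq_mul_left hu f3
    rfl

lemma le_integral_norm_weylSum_pow_four {N : ℕ} (hN : 256 ≤ N) :
    1 / 768 * ((N : ℝ) ^ 2 * Real.log N) ≤ ∫ x in (0 : ℝ)..1, ‖weylSum N x‖ ^ 4 := by
  have hN' : (256 : ℝ) ≤ N := by exact_mod_cast hN
  have h1 : (N : ℝ) ^ 2 / 64 * ∑ w ∈ coprimePairs (N / 4), 1 / (w.2 : ℝ) ^ 2 ≤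
      ((∑ w ∈ coprimePairs (N / 4), (N / (4 * w.2)) ^ 2 : ℕ) : ℝ) := by
    rw [Finset.mul_sum, Nat.cast_sum]
    refine Finset.sum_le_sum fun w hw => ?_
    simp only [coprimePairs, Finset.mem_filter, Finset.mem_product, Finset.mem_Icc] at hw
    have hw1 : 0 < w.2 := hw.1.2.1
    have hw2 : 4 * w.2 ≤ N := by have := hw.1.2.2; omega
    have h2 : 1 ≤ N / (4 * w.2) := (Nat.one_le_div_iff (by omega)).mpr hw2
    have h3 : N < 4 * w.2 * (N / (4 * w.2) + 1) := Nat.lt_mul_div_succ N (by omega)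
    have h4 : N ≤ 8 * w.2 * (N / (4 * w.2)) := by nlinarith
    have h5 : (N : ℝ) ≤ 8 * w.2 * (N / (4 * w.2) : ℕ) := by exact_mod_cast h4
    have hw0 : (0 : ℝ) < w.2 := Nat.cast_pos.mpr hw1
    calc (N : ℝ) ^ 2 / 64 * (1 / (w.2 : ℝ) ^ 2) = ((N : ℝ) / (8 * w.2)) ^ 2 := by
          field_simp
          norm_num
      _ ≤ ((N / (4 * w.2) : ℕ) : ℝ) ^ 2 := by
          gcongr
          rw [div_le_iff₀ (by positivity)]
          linarith
      _ = _ := by push_cast; rfl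
  have h2 : (Real.log N / 2) ≤ Real.log ((N / 4 : ℕ) + 1) - 1 := by
    have h3 : (N : ℝ) / 4 ≤ (N / 4 : ℕ) + 1 := by
      have : N ≤ 4 * (N / 4 + 1) := by omega
      have : (N : ℝ) ≤ 4 * ((N / 4 : ℕ) + 1) := by exact_mod_cast this
      linarith
    have h4 := Real.log_le_log (by positivity) h3
    rw [Real.log_div (by positivity) (by norm_num)] at h4
    have h5 : 1 ≤ Real.log 4 := by
      rw [Real.le_log_iff_exp_le (by norm_num)]
      linarith [Real.exp_one_lt_d9]
    have h6 : 4 * Real.log 4 ≤ Real.log N := by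
      have h7 := Real.log_le_log (by norm_num) hN'
      rw [show (256 : ℝ) = 4 ^ 4 by norm_num, Real.log_pow] at h7
      exact_mod_cast h7
    linarith
  have h3 := log_sub_one_le_sum_coprimePairs (N / 4)
  have h4 : ((∑ w ∈ coprimePairs (N / 4), (N / (4 * w.2)) ^ 2 : ℕ) : ℝ) ≤ _ :=
    Nat.cast_le.mpr (sum_coprimePairs_le_card N)
  rw [integral_norm_weylSum_pow_four]
  refine le_trans ?_ (h1.trans h4)
  have h5 : Real.log N / 12 ≤ ∑ w ∈ coprimePairs (N / 4), 1 / (w.2 : ℝ) ^ 2 := by linarith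
  calc 1 / 768 * ((N : ℝ) ^ 2 * Real.log N) = (N : ℝ) ^ 2 / 64 * (Real.log N / 12) := by ring
    _ ≤ _ := by gcongr

/-- Zalcwasser's theorem: for every `p > 0` there are `M_p > 1` and constants
`C_p > c_p > 0` such that for every integer `N > M_p`,
`c_p · ψ_p(N) ≤ ∫₀¹ |∑_{m=1}^N e^{2πim²x}|^p dx ≤ C_p · ψ_p(N)`. -/
theorem zalcwasser (p : ℝ) (hp : 0 < p) :
    ∃ M c C : ℝ, 1 < M ∧ 0 < c ∧ c < C ∧ ∀ N : ℕ, M < (N : ℝ) →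
      c * zalcPsi p N ≤ (∫ x in (0:ℝ)..1, ‖weylSum N x‖ ^ p) ∧
      (∫ x in (0:ℝ)..1, ‖weylSum N x‖ ^ p) ≤ C * zalcPsi p N := by
  suffices h : ∃ c > 0, ∃ C : ℝ, ∀ N : ℕ, 256 < N →
      c * zalcPsi p N ≤ (∫ x in (0 : ℝ)..1, ‖weylSum N x‖ ^ p) ∧
      (∫ x in (0 : ℝ)..1, ‖weylSum N x‖ ^ p) ≤ C * zalcPsi p N by
    obtain ⟨c, hc, C, h⟩ := h
    refine ⟨256, c, max C (c + 1), by norm_num, hc, lt_max_of_lt_right (by linarith),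
      fun N hN => ?_⟩
    have hψ : 0 ≤ zalcPsi p N := by
      unfold zalcPsi
      split_ifs <;> positivity
    obtain ⟨h1, h2⟩ := h N (by exact_mod_cast hN)
    exact ⟨h1, h2.trans (mul_le_mul_of_nonneg_right (le_max_left _ _) hψ)⟩
  rcases lt_trichotomy p 4 with hp4 | rfl | hp4
  · have hψ : ∀ N, zalcPsi p N = (N : ℝ) ^ (p / 2) := fun N => if_pos hp4
    have hupper : ∃ C > 0, ∀ N : ℕ, 0 < N →
        ∫ x in (0 : ℝ)..1, ‖weylSum N x‖ ^ p ≤ C * (N : ℝ) ^ (p / 2) := by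
      rcases le_or_gt p 2 with h | h
      · exact exists_integral_weylSum_rpow_le_of_le_two hp h
      · exact exists_integral_weylSum_rpow_le_of_lt_four h hp4
    have hlower : ∃ c > 0, ∀ N : ℕ, 0 < N →
        c * (N : ℝ) ^ (p / 2) ≤ ∫ x in (0 : ℝ)..1, ‖weylSum N x‖ ^ p := by
      rcases lt_or_ge p 2 with h | h
      · exact exists_le_integral_weylSum_rpow_of_lt_two hp h
      · refine ⟨(1 / 2) ^ (p / 2), by positivity, fun N hN => ?_⟩
        rw [← Real.mul_rpow (by norm_num) (by positivity), one_div_mul_eq_div]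
        exact le_integral_weylSum_rpow_of_two_le h hN
    obtain ⟨C, -, hC⟩ := hupper
    obtain ⟨c, hc, hc'⟩ := hlower
    refine ⟨c, hc, C, fun N hN => ?_⟩
    rw [hψ]
    exact ⟨hc' N (by omega), hC N (by omega)⟩
  · have hψ : ∀ N, zalcPsi 4 N = (N : ℝ) ^ 2 * Real.log N := fun N => by simp [zalcPsi]
    obtain ⟨C, -, hC⟩ := exists_integral_weylSum_rpow_four_le
    refine ⟨1 / 768, by norm_num, C, fun N hN => ?_⟩
    rw [hψ]
    refine ⟨?_, hC N (by omega)⟩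
    have h := le_integral_norm_weylSum_pow_four hN.le
    exact_mod_cast h
  · have hψ : ∀ N, zalcPsi p N = (N : ℝ) ^ (p - 2) := fun N => by
      simp [zalcPsi, hp4.not_gt, hp4.ne']
    obtain ⟨C, -, hC⟩ := exists_integral_weylSum_rpow_le_of_four_lt hp4
    refine ⟨(1 / 2) ^ p / 8, by positivity, C, fun N hN => ?_⟩
    rw [hψ]
    exact ⟨le_integral_weylSum_rpow hp (by omega), hC N (by omega)⟩
end
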